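/- arXiv:2310.07318 — 5 statements merged into one kernel-verified Lean document; each statement's English description precedes it below -/
import Mathlib

section
/- The double integral ∫∫_{(0,∞)²} Li^{Ш,⋆}_{1,1}(1-e^{t₁+t₂}, 1-e^{t₂})/(1-e^{t₁+t₂}) dt₁ dt₂ equals ζ(1,1,2) + 2ζ(2,2), where ζ denotes multiple zeta values with the convention ζ(k₁,...,k_r) = Σ_{0<m₁<⋯<m_r} 1/(m₁^{k₁}⋯m_r^{k_r}). -/
open MeasureTheory

/-- Multiple zeta value `ζ(k₁,…,k_r) = Σ_{0<m₁<⋯<m_r} ∏ mᵢ^{-kᵢ}`. -/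
noncomputable def mzv (k : List ℕ) : ℝ :=
  ∑' m : {f : Fin k.length → ℕ+ // StrictMono f},
    ∏ i : Fin k.length, ((m.1 i : ℝ) ^ (k.get i))⁻¹

/-- The analytic continuation of
`Li^{Ш,⋆}_{1,1}(z₁,z₂) = Σ_{l₁≥1, l₂≥0} z₁^{l₁} z₂^{l₂}/(l₁(l₁+l₂))` to negative
real arguments, given (using `1/(l₁+l₂) = ∫_0^1 s^{l₁+l₂-1} ds`) by the integral
`∫_0^1 (-log(1-z₁ s))/(s(1-z₂ s)) ds`. -/
noncomputable def LiShaStar11 (z₁ z₂ : ℝ) : ℝ :=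
  ∫ s in (0 : ℝ)..1, (-Real.log (1 - z₁ * s)) / (s * (1 - z₂ * s))

theorem shear (K : ℝ → ℝ → ENNReal) (hK : Measurable (Function.uncurry K)) :
    ∫⁻ t₁ in Set.Ioi (0:ℝ), ∫⁻ t₂ in Set.Ioi (0:ℝ), K (t₁+t₂) t₂ =
    ∫⁻ T in Set.Ioi (0:ℝ), ∫⁻ t₂ in Set.Ioo (0:ℝ) T, K T t₂ := by
  have hK' : ∀ f g : ℝ × ℝ → ℝ, Measurable f → Measurable g → Measurable (fun p => K (f p) (g p)) :=
    fun f g hf hg => hK.comp (hf.prodMk hg)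
  rw [lintegral_lintegral_swap (hK' (fun p => p.1 + p.2) _ (by fun_prop) measurable_snd).aemeasurable]
  have h1 : ∀ t₂ : ℝ, ∫⁻ t₁ in Set.Ioi (0:ℝ), K (t₁+t₂) t₂ =
      ∫⁻ T, (Set.Ioi t₂).indicator (fun T => K T t₂) T := by
    intro t₂
    rw [← lintegral_indicator measurableSet_Ioi,
      ← lintegral_add_right_eq_self ((Set.Ioi t₂).indicator (fun T => K T t₂)) t₂]
    congr 1; ext x
    simp [Set.indicator]
  simp_rw [h1]
  have h2 : Measurable (fun p : ℝ × ℝ => (Set.Ioi p.1).indicator (fun T => K T p.1) p.2) := by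
    have : (fun p : ℝ × ℝ => (Set.Ioi p.1).indicator (fun T => K T p.1) p.2) =
      Set.indicator {p : ℝ × ℝ | p.1 < p.2} (fun p => K p.2 p.1) := by
      ext p; simp [Set.indicator]
    rw [this]
    exact (hK' _ _ measurable_snd measurable_fst).indicator (measurableSet_lt measurable_fst measurable_snd)
  rw [lintegral_lintegral_swap h2.aemeasurable, ← lintegral_indicator measurableSet_Ioi]
  congr 1; ext T
  simp only [Set.indicator, Set.mem_Ioi]
  rw [← lintegral_indicator measurableSet_Ioi]
  split_ifs with hT
  · rw [← lintegral_indicator measurableSet_Ioo]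
    congr 1; ext t
    by_cases h : 0 < t <;> by_cases h' : t < T <;> simp [Set.indicator, h, h']
  · rw [← lintegral_zero (α := ℝ) (μ := volume)]
    congr 1; ext t
    by_cases h : 0 < t <;> simp [Set.indicator, h]
    intro h'; linarith

/-- The connector of Seki and Yamamoto. -/
noncomputable def conn (m n : ℕ) : ℝ := (((m + n).choose m : ℕ) : ℝ)⁻¹

theorem conn_nonneg (m n : ℕ) : 0 ≤ conn m n := by unfold conn; positivity

theorem conn_symm (m n : ℕ) : conn m n = conn n m := by
  unfold conn
  rw [add_comm m n, Nat.choose_symm_add]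

theorem conn_zero (n : ℕ) : conn 0 n = 1 := by simp [conn]

theorem conn_step (m n : ℕ) (hn : n ≠ 0) :
    1 / ((m : ℝ) + 1) * conn (m + 1) n = 1 / n * conn m n - 1 / n * conn (m + 1) n := by
  have h := Nat.add_one_mul_choose_eq (m + n) m
  have h' : ((m : ℝ) + n + 1) * ((m + n).choose m : ℕ) =
      ((m + 1 + n).choose (m + 1) : ℕ) * ((m : ℝ) + 1) := by
    rw [show m + 1 + n = m + n + 1 by ring]; exact_mod_cast h
  unfold conn
  have h1 : (((m + n).choose m : ℕ) : ℝ) ≠ 0 := by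
    exact_mod_cast (Nat.choose_pos (by omega)).ne'
  have h2 : (((m + 1 + n).choose (m + 1) : ℕ) : ℝ) ≠ 0 := by
    exact_mod_cast (Nat.choose_pos (by omega)).ne'
  have hn' : (n : ℝ) ≠ 0 := by exact_mod_cast hn
  have hm : (m : ℝ) + 1 ≠ 0 := by positivity
  field_simp
  linear_combination h'

theorem conn_le (m n : ℕ) (hn : n ≠ 0) : conn m n ≤ 1 / ((m : ℝ) + 1) := by
  unfold conn
  rw [one_div]
  apply inv_anti₀ (by positivity)
  have : (m + 1).choose m ≤ (m + n).choose m := Nat.choose_le_choose _ (by omega)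
  rw [Nat.choose_succ_self_right] at this
  exact_mod_cast this

theorem conn_sum (m n : ℕ) (hn : n ≠ 0) :
    ∑' a : ℕ, ENNReal.ofReal (1 / ((m : ℝ) + a + 1) * conn (m + a + 1) n) =
      ENNReal.ofReal (1 / n * conn m n) := by
  have hs : HasSum (fun a : ℕ => 1 / ((m : ℝ) + a + 1) * conn (m + a + 1) n) (1 / n * conn m n) := by
    rw [hasSum_iff_tendsto_nat_of_nonneg
      (fun a => mul_nonneg (by positivity) (conn_nonneg _ _))]
    have h1 : ∀ N : ℕ, ∑ a ∈ Finset.range N, 1 / ((m : ℝ) + a + 1) * conn (m + a + 1) n =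
        1 / n * conn m n - 1 / n * conn (m + N) n := by
      intro N
      induction N with
      | zero => simp
      | succ k ih =>
        rw [Finset.sum_range_succ, ih]
        have := conn_step (m + k) n hn
        push_cast at this
        rw [this, ← add_assoc]
        ring
    simp_rw [h1]
    have h2 : Filter.Tendsto (fun N => conn (m + N) n) Filter.atTop (nhds 0) := by
      refine squeeze_zero (fun N => conn_nonneg _ _) (fun N => (conn_le (m + N) n hn).trans ?_)
        (tendsto_one_div_add_atTop_nhds_zero_nat (𝕜 := ℝ))
      push_cast
      gcongr
      linarith [(Nat.cast_nonneg m : (0:ℝ) ≤ m)]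
    simpa using (h2.const_mul (1 / (n:ℝ))).const_sub (1 / n * conn m n)
  rw [← hs.tsum_eq, ENNReal.ofReal_tsum_of_nonneg
    (fun a => mul_nonneg (by positivity) (conn_nonneg _ _)) hs.summable]

/-- reciprocal in `ENNReal` -/
noncomputable def rc (n : ℕ) : ENNReal := ENNReal.ofReal (1 / (n : ℝ))

noncomputable def cE (m n : ℕ) : ENNReal := ENNReal.ofReal (conn m n)

theorem cE_sum (m n : ℕ) (hn : n ≠ 0) :
    ∑' a : ℕ, rc (m + a + 1) * cE (m + a + 1) n = rc n * cE m n := by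
  unfold rc cE
  rw [← ENNReal.ofReal_mul (by positivity), ← conn_sum m n hn]
  congr 1; ext a
  rw [← ENNReal.ofReal_mul (by positivity)]
  push_cast; rfl

theorem rc_sum (m : ℕ) (hm : m ≠ 0) : ∑' a : ℕ, rc (a + 1) * cE m (a + 1) = rc m := by
  have h := cE_sum 0 m hm
  simp only [zero_add] at h
  have h0 : cE 0 m = 1 := by simp [cE, conn_zero]
  rw [h0, mul_one] at h
  rw [← h]
  congr 1; ext a
  unfold cE
  rw [conn_symm]

theorem z112 : ∑' a : ℕ, ∑' b : ℕ, ∑' c : ℕ,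
    rc (a + 1) * rc (a + 1 + b + 1) * rc (a + 1 + b + 1 + c + 1) ^ 2 =
    ∑' n : ℕ, rc (n + 1) ^ 4 := by
  have h1 : ∀ a b : ℕ, ∑' c : ℕ,
      rc (a + 1) * rc (a + 1 + b + 1) * rc (a + 1 + b + 1 + c + 1) ^ 2 =
      ∑' n : ℕ, rc (a + 1) * rc (n + 1) ^ 2 * (rc (a + 1 + b + 1) * cE (a + 1 + b + 1) (n + 1)) := by
    intro a b
    have : ∀ c : ℕ, rc (a + 1) * rc (a + 1 + b + 1) * rc (a + 1 + b + 1 + c + 1) ^ 2 =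
      ∑' n : ℕ, rc (a + 1) * rc (a + 1 + b + 1) * rc (n + 1) *
        (rc (a + 1 + b + 1 + c + 1) * cE (a + 1 + b + 1 + c + 1) (n + 1)) := by
      intro c
      rw [pow_two]
      nth_rewrite 2 [← rc_sum (a + 1 + b + 1 + c + 1) (by omega)]
      rw [← ENNReal.tsum_mul_left, ← ENNReal.tsum_mul_left]
      congr 1; ext n; ring
    simp_rw [this]
    rw [ENNReal.tsum_comm]
    congr 1; ext n
    rw [ENNReal.tsum_mul_left, cE_sum _ _ (by omega)]
    ring
  simp_rw [h1]
  have h2 : ∀ a : ℕ, ∑' b : ℕ, ∑' n : ℕ,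
      rc (a + 1) * rc (n + 1) ^ 2 * (rc (a + 1 + b + 1) * cE (a + 1 + b + 1) (n + 1)) =
      ∑' n : ℕ, rc (n + 1) ^ 3 * (rc (0 + a + 1) * cE (0 + a + 1) (n + 1)) := by
    intro a
    rw [ENNReal.tsum_comm]
    congr 1; ext n
    rw [ENNReal.tsum_mul_left, cE_sum _ _ (by omega), zero_add]
    ring
  simp_rw [h2]
  rw [ENNReal.tsum_comm]
  congr 1; ext n
  rw [ENNReal.tsum_mul_left, cE_sum _ _ (by omega)]
  simp [cE, conn_zero]
  ring

theorem tsum_lt_shift (g : ℕ → ENNReal) (a : ℕ) :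
    ∑' b : ℕ, (if a < b then g b else 0) = ∑' c : ℕ, g (a + c + 1) := by
  have hi : Function.Injective (fun c : ℕ => a + c + 1) := fun x y h => by
    simp at h; exact h
  rw [← hi.tsum_eq (f := fun b => if a < b then g b else 0)]
  · congr 1; ext c
    rw [if_pos (by omega)]
  · intro b hb
    simp at hb
    exact ⟨b - a - 1, by simp; omega⟩

theorem sq_split (x : ℕ → ENNReal) :
    (∑' a, x a) ^ 2 = ∑' a, x a ^ 2 + 2 * ∑' a, ∑' c, x a * x (a + c + 1) := by
  have h0 : (∑' a, x a) ^ 2 = ∑' a, ∑' b, x a * x b := by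
    simp_rw [ENNReal.tsum_mul_left, ENNReal.tsum_mul_right]; ring
  have h1 : ∀ a b, x a * x b = (if b = a then x a * x b else 0) +
      ((if a < b then x a * x b else 0) + (if b < a then x a * x b else 0)) := by
    intro a b
    rcases lt_trichotomy a b with h | h | h
    · simp [h, h.ne', not_lt.mpr h.le]
    · simp [h]
    · simp [h, h.ne, not_lt.mpr h.le]
  have h2 : ∑' a, ∑' b, (if a < b then x a * x b else 0) = ∑' a, ∑' c, x a * x (a + c + 1) := by
    congr 1; ext a
    exact tsum_lt_shift (fun b => x a * x b) a
  have h3 : ∑' a, ∑' b, (if b < a then x a * x b else 0) = ∑' a, ∑' c, x a * x (a + c + 1) := by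
    rw [ENNReal.tsum_comm, ← h2]
    congr 1; ext a; congr 1; ext b
    rw [mul_comm]
  rw [h0]
  rw [tsum_congr fun a => tsum_congr (h1 a)]
  simp_rw [ENNReal.tsum_add]
  rw [h2, h3, two_mul]
  congr 2; ext a
  rw [tsum_ite_eq, pow_two]

def eq2 : ℕ × ℕ ≃ {f : Fin 2 → ℕ+ // StrictMono f} where
  toFun p := ⟨![⟨p.1 + 1, by omega⟩, ⟨p.1 + 1 + p.2 + 1, by omega⟩], by
    rw [Fin.strictMono_iff_lt_succ]
    intro i
    fin_cases i
    change p.1 + 1 < p.1 + 1 + p.2 + 1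
    omega⟩
  invFun f := ((f.1 0 : ℕ) - 1, (f.1 1 : ℕ) - (f.1 0 : ℕ) - 1)
  left_inv p := by
    ext <;> simp <;> omega
  right_inv f := by
    have h0 := (f.1 0).pos
    have h1 : (f.1 0 : ℕ) < f.1 1 := f.2 (by decide)
    apply Subtype.ext
    funext i
    apply PNat.eq
    fin_cases i <;> simp <;> omega

def eq3 : ℕ × ℕ × ℕ ≃ {f : Fin 3 → ℕ+ // StrictMono f} where
  toFun p := ⟨![⟨p.1 + 1, by omega⟩, ⟨p.1 + 1 + p.2.1 + 1, by omega⟩,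
      ⟨p.1 + 1 + p.2.1 + 1 + p.2.2 + 1, by omega⟩], by
    rw [Fin.strictMono_iff_lt_succ]
    intro i
    fin_cases i
    · change p.1 + 1 < p.1 + 1 + p.2.1 + 1
      omega
    · change p.1 + 1 + p.2.1 + 1 < p.1 + 1 + p.2.1 + 1 + p.2.2 + 1
      omega⟩
  invFun f := ((f.1 0 : ℕ) - 1, (f.1 1 : ℕ) - (f.1 0 : ℕ) - 1, (f.1 2 : ℕ) - (f.1 1 : ℕ) - 1)
  left_inv p := by
    ext <;> simp <;> omega
  right_inv f := by
    have h0 := (f.1 0).pos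
    have h1 : (f.1 0 : ℕ) < f.1 1 := f.2 (by decide)
    have h2 : (f.1 1 : ℕ) < f.1 2 := f.2 (by decide)
    apply Subtype.ext
    funext i
    apply PNat.eq
    fin_cases i <;> simp <;> omega

theorem rc_toReal (n : ℕ) : (rc n).toReal = ((n : ℝ))⁻¹ := by
  unfold rc; rw [ENNReal.toReal_ofReal (by positivity), one_div]

theorem rc_ne_top (n : ℕ) : rc n ≠ ⊤ := by simp [rc]

theorem mzv22 : mzv [2, 2] =
    (∑' a : ℕ, ∑' c : ℕ, rc (a + 1) ^ 2 * rc (a + c + 1 + 1) ^ 2).toReal := by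
  rw [← ENNReal.tsum_prod (f := fun a c => rc (a + 1) ^ 2 * rc (a + c + 1 + 1) ^ 2),
    ENNReal.tsum_toReal_eq
      (fun p => ENNReal.mul_ne_top (ENNReal.pow_ne_top (rc_ne_top _))
        (ENNReal.pow_ne_top (rc_ne_top _)))]
  unfold mzv
  refine (eq2.tsum_eq (fun m : {f : Fin 2 → ℕ+ // StrictMono f} => ∏ i : Fin 2, ((m.1 i : ℝ) ^ ([2,2].get i))⁻¹)).symm.trans ?_
  congr 1; ext p
  rw [Fin.prod_univ_two]
  simp [eq2, rc_toReal]
  left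
  ring

theorem mzv112 : mzv [1, 1, 2] = (∑' n : ℕ, rc (n + 1) ^ 4).toReal := by
  rw [← z112]
  simp_rw [← ENNReal.tsum_prod (f := fun b c =>
    rc (_ + 1) * rc (_ + 1 + b + 1) * rc (_ + 1 + b + 1 + c + 1) ^ 2)]
  rw [← ENNReal.tsum_prod (f := fun a (p : ℕ × ℕ) =>
    rc (a + 1) * rc (a + 1 + p.1 + 1) * rc (a + 1 + p.1 + 1 + p.2 + 1) ^ 2),
    ENNReal.tsum_toReal_eq
      (fun p => ENNReal.mul_ne_top (ENNReal.mul_ne_top (rc_ne_top _) (rc_ne_top _))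
        (ENNReal.pow_ne_top (rc_ne_top _)))]
  unfold mzv
  refine (eq3.tsum_eq (fun m : {f : Fin 3 → ℕ+ // StrictMono f} => ∏ i : Fin 3, ((m.1 i : ℝ) ^ ([1,1,2].get i))⁻¹)).symm.trans ?_
  congr 1; ext p
  rw [Fin.prod_univ_three]
  simp [eq3, rc_toReal]

theorem zeta2_ne_top : ∑' n : ℕ, rc (n + 1) ^ 2 ≠ ⊤ := by
  have h : Summable (fun n : ℕ => (1 / ((n + 1 : ℕ) : ℝ)) ^ 2) := by
    have := (summable_nat_add_iff 1).mpr (Real.summable_one_div_nat_pow.mpr (by norm_num : 1 < 2))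
    simpa using this
  have h2 : ∑' n : ℕ, rc (n + 1) ^ 2 = ENNReal.ofReal (∑' n : ℕ, (1 / ((n + 1 : ℕ) : ℝ)) ^ 2) := by
    rw [ENNReal.ofReal_tsum_of_nonneg (fun n => by positivity) h]
    congr 1; ext n
    rw [rc, ENNReal.ofReal_pow (by positivity)]
  rw [h2]; exact ENNReal.ofReal_ne_top

theorem series_part :
    ((∑' n : ℕ, rc (n + 1) ^ 2) ^ 2).toReal = mzv [1,1,2] + 2 * mzv [2,2] := by
  have h := sq_split (fun n => rc (n + 1) ^ 2)
  have hne : (∑' n : ℕ, rc (n + 1) ^ 2) ^ 2 ≠ ⊤ := ENNReal.pow_ne_top zeta2_ne_top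
  rw [h] at hne
  rw [h, mzv112, mzv22]
  obtain ⟨h1, h2⟩ := ENNReal.add_ne_top.mp hne
  rw [ENNReal.toReal_add h1 h2, ENNReal.toReal_mul]
  simp_rw [← pow_mul]
  norm_num

theorem lint_exp (n : ℕ) : ∫⁻ w in Set.Ioi (0:ℝ), ENNReal.ofReal (w * Real.exp (-((n+1:ℕ) * w))) =
    rc (n + 1) ^ 2 := by
  have h := Real.integral_rpow_mul_exp_neg_mul_Ioi (a := 2) (r := ((n+1 : ℕ):ℝ)) (by norm_num)
    (by positivity)
  have e : ∀ t : ℝ, t ^ ((2:ℝ) - 1) = t := by intro t; norm_num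
  simp_rw [e] at h
  rw [Real.Gamma_two, mul_one] at h
  have hpos : (0:ℝ) < (1 / ((n + 1 : ℕ) : ℝ)) ^ (2:ℝ) := by positivity
  have hi : IntegrableOn (fun t : ℝ => t * Real.exp (-((n+1:ℕ) * t))) (Set.Ioi 0) := by
    by_contra hc
    rw [integral_undef hc] at h
    exact hpos.ne h
  rw [← ofReal_integral_eq_lintegral_ofReal hi, h, rc, ← ENNReal.ofReal_pow (by positivity)]
  · norm_num
  · filter_upwards [ae_restrict_mem measurableSet_Ioi] with x hx
    have : (0:ℝ) < x := hx
    simp only [Pi.zero_apply]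
    positivity

theorem lint_bose : ∫⁻ w in Set.Ioi (0:ℝ), ENNReal.ofReal (w / (Real.exp w - 1)) =
    ∑' n : ℕ, rc (n + 1) ^ 2 := by
  simp_rw [← lint_exp]
  rw [← lintegral_tsum (fun n => by fun_prop)]
  apply setLIntegral_congr_fun measurableSet_Ioi
  intro w hw
  have hw : (0:ℝ) < w := hw
  have he : 1 < Real.exp w := Real.one_lt_exp_iff.mpr hw
  have hg := (hasSum_geometric_of_lt_one (Real.exp_pos (-w)).le
    (by rw [Real.exp_lt_one_iff]; linarith)).mul_left (w * Real.exp (-w))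
  have e1 : w * Real.exp (-w) * (1 - Real.exp (-w))⁻¹ = w / (Real.exp w - 1) := by
    have h2 : Real.exp w - 1 ≠ 0 := by linarith
    rw [Real.exp_neg]
    have h3 : 1 - (Real.exp w)⁻¹ ≠ 0 := by
      have : (Real.exp w)⁻¹ < 1 := inv_lt_one_of_one_lt₀ he
      linarith
    field_simp
  have e2 : ∀ n : ℕ, w * Real.exp (-w) * Real.exp (-w) ^ n = w * Real.exp (-((n+1:ℕ) * w)) := by
    intro n
    rw [mul_assoc, ← pow_succ', ← Real.exp_nat_mul]
    ring_nf
  rw [e1] at hg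
  simp_rw [e2] at hg
  simp only
  rw [← hg.tsum_eq, ENNReal.ofReal_tsum_of_nonneg (fun n => by positivity) hg.summable]

/-- The integrand. -/
noncomputable def gI (T t s : ℝ) : ℝ :=
  Real.log (1 + (Real.exp T - 1) * s) / (s * (1 + (Real.exp t - 1) * s)) / (Real.exp T - 1)

theorem gI_meas : Measurable (fun p : ℝ × ℝ × ℝ => gI p.1 p.2.1 p.2.2) := by
  unfold gI
  fun_prop

theorem gI_nonneg {T t s : ℝ} (hT : 0 < T) (ht : 0 < t) (hs : 0 < s) : 0 ≤ gI T t s := by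
  have h1 : 0 < Real.exp T - 1 := by linarith [Real.one_lt_exp_iff.mpr hT]
  have h2 : 0 < Real.exp t - 1 := by linarith [Real.one_lt_exp_iff.mpr ht]
  have h3 : 0 ≤ Real.log (1 + (Real.exp T - 1) * s) := Real.log_nonneg (by nlinarith)
  unfold gI
  positivity

theorem gI_t_int {T s : ℝ} (hT : 0 < T) (hs : 0 < s) (hs1 : s < 1) :
    ∫⁻ t in Set.Ioo 0 T, ENNReal.ofReal (gI T t s) =
      ENNReal.ofReal (Real.log (1 + (Real.exp T - 1) * s) *
        (T - Real.log (1 + (Real.exp T - 1) * s)) / (s * (1 - s) * (Real.exp T - 1))) := by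
  have hpos : ∀ t : ℝ, 0 < 1 + (Real.exp t - 1) * s := by
    intro t
    have := mul_pos (Real.exp_pos t) hs
    linarith
  have h1 : 0 < Real.exp T - 1 := by linarith [Real.one_lt_exp_iff.mpr hT]
  have hc : Continuous (fun t => gI T t s) := by
    unfold gI
    refine Continuous.div_const (Continuous.div continuous_const (by fun_prop) ?_) _
    intro t
    exact (mul_pos hs (hpos t)).ne'
  have hF := intervalIntegral.integral_eq_sub_of_hasDerivAt (a := 0) (b := T)
    (f := fun t => Real.log (1 + (Real.exp T - 1) * s) *
      (t - Real.log (1 + (Real.exp t - 1) * s)) / (s * (1 - s) * (Real.exp T - 1)))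
    (f' := fun t => gI T t s) (by
      intro t _
      have hd : HasDerivAt (fun t => 1 + (Real.exp t - 1) * s) (Real.exp t * s) t :=
        (((Real.hasDerivAt_exp t).sub_const 1).mul_const s).const_add 1
      have := ((((hasDerivAt_id t).sub (hd.log (hpos t).ne')).const_mul
        (Real.log (1 + (Real.exp T - 1) * s))).div_const (s * (1 - s) * (Real.exp T - 1)))
      refine this.congr_deriv ?_
      unfold gI
      have a1 := (hpos t).ne'
      have a2 : 1 - s ≠ 0 := by linarith
      have a4 : Real.exp t * s = (1 + (Real.exp t - 1) * s) - (1 - s) := by ring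
      rw [a4]
      generalize 1 + (Real.exp t - 1) * s = D at *
      have a3 := h1.ne'
      generalize Real.log (1 + (Real.exp T - 1) * s) = L
      field_simp
      ring) (hc.intervalIntegrable _ _)
  rw [intervalIntegral.integral_of_le hT.le, integral_Ioc_eq_integral_Ioo] at hF
  simp only [Real.exp_zero, sub_self, zero_mul, add_zero, Real.log_one, mul_zero, zero_div, sub_zero] at hF
  rw [← hF, ofReal_integral_eq_lintegral_ofReal]
  · exact (hc.integrableOn_Icc (a := 0) (b := T)).mono_set Set.Ioo_subset_Icc_self
  · filter_upwards [ae_restrict_mem measurableSet_Ioo] with t ht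
    exact gI_nonneg hT ht.1 hs

theorem gI_s_int {T : ℝ} (hT : 0 < T) :
    ∫⁻ s in Set.Ioo (0:ℝ) 1, ENNReal.ofReal (Real.log (1 + (Real.exp T - 1) * s) *
        (T - Real.log (1 + (Real.exp T - 1) * s)) / (s * (1 - s) * (Real.exp T - 1))) =
    ∫⁻ w in Set.Ioo (0:ℝ) T, ENNReal.ofReal (w / (Real.exp w - 1)) *
      ENNReal.ofReal ((T - w) / (Real.exp (T - w) - 1)) := by
  have h1 : 0 < Real.exp T - 1 := by linarith [Real.one_lt_exp_iff.mpr hT]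
  have himg : (fun w => (Real.exp w - 1) / (Real.exp T - 1)) '' Set.Ioo 0 T = Set.Ioo 0 1 := by
    ext s
    constructor
    · rintro ⟨w, ⟨hw0, hwT⟩, rfl⟩
      have h2 : 0 < Real.exp w - 1 := by linarith [Real.one_lt_exp_iff.mpr hw0]
      have h3 := Real.exp_lt_exp.mpr hwT
      exact ⟨by positivity, by rw [div_lt_one h1]; linarith⟩
    · rintro ⟨hs0, hs1⟩
      have h4 : 0 < (Real.exp T - 1) * s := by positivity
      refine ⟨Real.log (1 + (Real.exp T - 1) * s), ⟨Real.log_pos (by linarith), ?_⟩, ?_⟩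
      · rw [Real.log_lt_iff_lt_exp (by linarith)]
        nlinarith
      · simp only
        rw [Real.exp_log (by linarith)]
        field_simp
        ring
  rw [← himg, lintegral_image_eq_lintegral_abs_deriv_mul (f' := fun w => Real.exp w / (Real.exp T - 1))
    measurableSet_Ioo]
  · apply setLIntegral_congr_fun measurableSet_Ioo
    rintro w ⟨hw0, hwT⟩
    have h2 : 0 < Real.exp w - 1 := by linarith [Real.one_lt_exp_iff.mpr hw0]
    have h3 := Real.exp_lt_exp.mpr hwT
    have h4 : 0 < Real.exp (T - w) - 1 := by
      linarith [Real.one_lt_exp_iff.mpr (by linarith : 0 < T - w)]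
    have e1 : 1 + (Real.exp T - 1) * ((Real.exp w - 1) / (Real.exp T - 1)) = Real.exp w := by
      field_simp
      ring
    simp only
    rw [e1, Real.log_exp, abs_of_pos (by positivity), ← ENNReal.ofReal_mul (by positivity),
      ← ENNReal.ofReal_mul (by positivity)]
    congr 1
    have e2 : Real.exp (T - w) - 1 = (Real.exp T - Real.exp w) / Real.exp w := by
      rw [Real.exp_sub]; field_simp
    have e3 : 1 - (Real.exp w - 1) / (Real.exp T - 1) =
        (Real.exp T - Real.exp w) / (Real.exp T - 1) := by
      field_simp; ring
    rw [e2, e3]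
    have h5 : Real.exp T - Real.exp w ≠ 0 := by linarith
    have h6 := h2.ne'
    have h7 := h1.ne'
    field_simp
  · intro w _
    exact (((Real.hasDerivAt_exp w).sub_const 1).div_const _).hasDerivWithinAt
  · intro x _ y _ hxy
    simp only at hxy
    rw [div_left_inj' h1.ne'] at hxy
    exact Real.exp_injective (by linarith)

theorem lint_main :
    ∫⁻ t₁ in Set.Ioi (0:ℝ), ∫⁻ t₂ in Set.Ioi (0:ℝ), ∫⁻ s in Set.Ioo (0:ℝ) 1,
      ENNReal.ofReal (gI (t₁ + t₂) t₂ s) = (∑' n : ℕ, rc (n + 1) ^ 2) ^ 2 := by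
  have hm := gI_meas
  rw [shear (fun T t => ∫⁻ s in Set.Ioo (0:ℝ) 1, ENNReal.ofReal (gI T t s))]
  · have h1 : ∀ T ∈ Set.Ioi (0:ℝ), ∫⁻ t in Set.Ioo (0:ℝ) T, ∫⁻ s in Set.Ioo (0:ℝ) 1,
        ENNReal.ofReal (gI T t s) = ∫⁻ w in Set.Ioo (0:ℝ) T,
        ENNReal.ofReal (w / (Real.exp w - 1)) * ENNReal.ofReal ((T - w) / (Real.exp (T - w) - 1)) := by
      intro T hT
      rw [lintegral_lintegral_swap, ← gI_s_int hT]
      · apply setLIntegral_congr_fun measurableSet_Ioo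
        rintro s ⟨hs0, hs1⟩
        exact gI_t_int hT hs0 hs1
      · exact (ENNReal.measurable_ofReal.comp
          (hm.comp ((measurable_const (a := T)).prodMk measurable_id))).aemeasurable
    rw [setLIntegral_congr_fun measurableSet_Ioi h1,
      ← shear (fun T w => ENNReal.ofReal (w / (Real.exp w - 1)) *
        ENNReal.ofReal ((T - w) / (Real.exp (T - w) - 1)))]
    · simp only [add_sub_cancel_right]
      have h2 : ∀ t₁ : ℝ, ∫⁻ t₂ in Set.Ioi (0:ℝ), ENNReal.ofReal (t₂ / (Real.exp t₂ - 1)) *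
          ENNReal.ofReal (t₁ / (Real.exp t₁ - 1)) =
          (∑' n : ℕ, rc (n + 1) ^ 2) * ENNReal.ofReal (t₁ / (Real.exp t₁ - 1)) := by
        intro t₁
        rw [lintegral_mul_const _ (by fun_prop), lint_bose]
      simp_rw [h2]
      rw [lintegral_const_mul _ (by fun_prop), lint_bose, pow_two]
    · unfold Function.uncurry
      fun_prop
  · have : Measurable (fun q : (ℝ × ℝ) × ℝ => ENNReal.ofReal (gI q.1.1 q.1.2 q.2)) :=
      by
      unfold gI
      fun_prop
    exact this.lintegral_prod_right'

theorem eta_star_value :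
    (∫ t₁ in Set.Ioi (0 : ℝ), ∫ t₂ in Set.Ioi (0 : ℝ),
        LiShaStar11 (1 - Real.exp (t₁ + t₂)) (1 - Real.exp t₂) /
          (1 - Real.exp (t₁ + t₂))) = mzv [1,1,2] + 2 * mzv [2,2] := by
  have hL : ∀ t₁ t₂ : ℝ, LiShaStar11 (1 - Real.exp (t₁ + t₂)) (1 - Real.exp t₂) /
      (1 - Real.exp (t₁ + t₂)) = ∫ s in Set.Ioo (0:ℝ) 1, gI (t₁ + t₂) t₂ s := by
    intro t₁ t₂
    unfold LiShaStar11
    rw [intervalIntegral.integral_of_le zero_le_one, integral_Ioc_eq_integral_Ioo,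
      ← integral_div]
    congr 1; ext s
    unfold gI
    rw [show 1 - (1 - Real.exp (t₁ + t₂)) * s = 1 + (Real.exp (t₁ + t₂) - 1) * s by ring,
      show 1 - (1 - Real.exp t₂) * s = 1 + (Real.exp t₂ - 1) * s by ring,
      show 1 - Real.exp (t₁ + t₂) = -(Real.exp (t₁ + t₂) - 1) by ring, neg_div, neg_div_neg_eq]
  simp_rw [hL]
  set μ : Measure ℝ := volume.restrict (Set.Ioi (0:ℝ)) with hμ
  set ν : Measure ℝ := volume.restrict (Set.Ioo (0:ℝ) 1) with hν
  let F : ℝ × ℝ × ℝ → ℝ := fun p => gI (p.1 + p.2.1) p.2.1 p.2.2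
  have hFm : Measurable F := by
    simp only [F]
    unfold gI
    fun_prop
  have hF0 : 0 ≤ᵐ[μ.prod (μ.prod ν)] F := by
    rw [hμ, hν, Measure.prod_restrict, Measure.prod_restrict]
    filter_upwards [ae_restrict_mem
      (measurableSet_Ioi.prod (measurableSet_Ioi.prod measurableSet_Ioo))] with p hp
    obtain ⟨h1, h2, h3, _⟩ := hp
    exact gI_nonneg (add_pos h1 h2) h2 h3
  have hlint : ∫⁻ p, ENNReal.ofReal (F p) ∂(μ.prod (μ.prod ν)) =
      (∑' n : ℕ, rc (n + 1) ^ 2) ^ 2 := by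
    rw [← lint_main, lintegral_prod _ (by fun_prop)]
    congr 1; ext t₁
    rw [lintegral_prod _ (by fun_prop)]
  have hint : Integrable F (μ.prod (μ.prod ν)) := by
    refine ⟨hFm.aestronglyMeasurable, ?_⟩
    rw [hasFiniteIntegral_iff_ofReal hF0, hlint]
    exact (ENNReal.pow_ne_top zeta2_ne_top).lt_top
  rw [← series_part, ← hlint, ← integral_eq_lintegral_of_nonneg_ae hF0 hFm.aestronglyMeasurable,
    integral_prod _ hint]
  apply integral_congr_ae
  filter_upwards [hint.prod_right_ae] with t₁ ht
  rw [integral_prod _ ht]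
end

section
/- The weight-5 multiple zeta values satisfy 6ζ(1,4) − ζ(3,2) − ζ(1,1,3) + ζ(1,2,2) = 0. -/
open scoped ENNReal Nat
open Filter Topology

namespace MZVProof

/-- `e n = 1/n` in `ℝ≥0∞` (with `e 0 = 0`). -/
noncomputable def e (n : ℕ) : ℝ≥0∞ := ENNReal.ofReal ((n : ℝ)⁻¹)

noncomputable def conn (n m : ℕ) : ℝ := (n ! : ℝ) * m ! / (n + m)!

noncomputable def K (n m : ℕ) : ℝ≥0∞ := ENNReal.ofReal (conn n m)

noncomputable def Z2 (p q : ℕ) : ℝ≥0∞ := ∑' i : ℕ, ∑' j : ℕ, e (i+1) ^ p * e (i+j+2) ^ q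

noncomputable def Z3 (p q r : ℕ) : ℝ≥0∞ :=
  ∑' i : ℕ, ∑' j : ℕ, ∑' k : ℕ, e (i+1) ^ p * e (i+j+2) ^ q * e (i+j+k+3) ^ r

lemma tsum_tele (u : ℕ → ℝ) (hu : Antitone u) (h0 : Tendsto u atTop (𝓝 0)) :
    ∑' k, ENNReal.ofReal (u k - u (k+1)) = ENNReal.ofReal (u 0) := by
  have h1 := ENNReal.tendsto_nat_tsum (fun k => ENNReal.ofReal (u k - u (k+1)))
  refine tendsto_nhds_unique h1 ?_
  have : (fun n => ∑ i ∈ Finset.range n, ENNReal.ofReal (u i - u (i+1)))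
      = fun n => ENNReal.ofReal (u 0 - u n) := by
    funext n
    rw [← ENNReal.ofReal_sum_of_nonneg, Finset.sum_range_sub']
    intro i _
    exact sub_nonneg.2 (hu (Nat.le_succ i))
  rw [this]
  have h2 : Tendsto (fun n => u 0 - u n) atTop (𝓝 (u 0 - 0)) := tendsto_const_nhds.sub h0
  rw [sub_zero] at h2
  exact (ENNReal.continuous_ofReal.tendsto _).comp h2

lemma conn_comm (n m : ℕ) : conn n m = conn m n := by
  unfold conn; rw [add_comm n m, mul_comm]

lemma conn_nonneg (n m : ℕ) : 0 ≤ conn n m := by unfold conn; positivity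

lemma conn_zero (n : ℕ) : conn n 0 = 1 := by
  unfold conn
  have : (n ! : ℝ) ≠ 0 := by positivity
  simp [this]

lemma conn_succ (n m : ℕ) : conn n (m+1) = conn n m * ((m+1) / (n+m+1)) := by
  unfold conn
  rw [← add_assoc, Nat.factorial_succ, Nat.factorial_succ]
  have : ((n+m)! : ℝ) ≠ 0 := by positivity
  have : (n + m + 1 : ℝ) ≠ 0 := by positivity
  push_cast
  field_simp

lemma conn_le_one (n m : ℕ) : conn n m ≤ 1 := by
  induction m with
  | zero => rw [conn_zero]
  | succ m ih =>
    rw [conn_succ]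
    have : ((m+1 : ℝ) / (n+m+1)) ≤ 1 := by
      rw [div_le_one (by positivity)]
      have : (0:ℝ) ≤ n := by positivity
      linarith
    exact mul_le_one₀ ih (by positivity) this

lemma conn_tendsto (m : ℕ) : Tendsto (fun n => conn n (m+1)) atTop (𝓝 0) := by
  have h : Tendsto (fun n : ℕ => ((m+1 : ℝ)) * (1 / ((n:ℝ) + 1))) atTop (𝓝 ((m+1 : ℝ) * 0)) :=
    tendsto_one_div_add_atTop_nhds_zero_nat.const_mul _
  rw [mul_zero] at h
  refine squeeze_zero (fun n => conn_nonneg _ _) (fun n => ?_) h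
  rw [conn_succ]
  calc conn n m * ((m+1) / (n+m+1)) ≤ 1 * ((m+1) / (n+m+1)) := by
        gcongr; exact conn_le_one _ _
    _ ≤ (m+1 : ℝ) * (1 / ((n:ℝ) + 1)) := by
        rw [one_mul, mul_one_div]
        gcongr
        have : (0:ℝ) ≤ m := by positivity
        linarith

lemma conn_step (n m : ℕ) :
    (((m+1 : ℕ) : ℝ)⁻¹ * conn n (m+1)) - (((m+1 : ℕ) : ℝ)⁻¹ * conn (n+1) (m+1))
      = ((n+1 : ℕ) : ℝ)⁻¹ * conn (n+1) (m+1) := by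
  rw [conn_comm (n+1), conn_succ (m+1) n, conn_comm (m+1) n]
  push_cast
  field_simp
  ring

lemma K_comm (n m : ℕ) : K n m = K m n := by unfold K; rw [conn_comm]

lemma K_zero (n : ℕ) : K n 0 = 1 := by simp [K, conn_zero]

lemma K_zero' (n : ℕ) : K 0 n = 1 := by rw [K_comm, K_zero]

lemma transport (a m : ℕ) :
    ∑' k, e (a+k+1) * K (a+k+1) (m+1) = e (m+1) * K a (m+1) := by
  have hmul : ∀ n m : ℕ, ∀ l, e l * K n m = ENNReal.ofReal ((l:ℝ)⁻¹ * conn n m) := by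
    intro n m l
    unfold e K
    rw [ENNReal.ofReal_mul (by positivity)]
  simp_rw [hmul]
  have key := tsum_tele (fun k => ((m+1 : ℕ) : ℝ)⁻¹ * conn (a+k) (m+1)) ?_ ?_
  · simp only [add_zero] at key
    rw [← key]
    refine tsum_congr fun k => ?_
    rw [← add_assoc, conn_step]
  · refine antitone_nat_of_succ_le fun k => ?_
    have := conn_step (a+k) m
    have h2 : 0 ≤ ((a+k+1 : ℕ) : ℝ)⁻¹ * conn (a+k+1) (m+1) :=
      mul_nonneg (by positivity) (conn_nonneg _ _)
    rw [← add_assoc]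
    linarith
  · have h := (conn_tendsto m).comp (tendsto_add_atTop_nat a)
    have h' := h.const_mul (((m+1 : ℕ) : ℝ)⁻¹)
    rw [mul_zero] at h'
    refine h'.congr fun k => ?_
    simp [add_comm]

lemma transport' (n m : ℕ) :
    e (n+1) * K (n+1) m = ∑' k, e (m+k+1) * K (n+1) (m+k+1) := by
  rw [K_comm, ← transport]
  simp_rw [K_comm (n+1)]

lemma SS (m : ℕ) :
    ∑' i, ∑' j, e (i+1) * (e (i+j+2) * K (i+j+2) (m+1)) = e (m+1) ^ 2 := by
  have h : ∀ i, ∑' j, e (i+1) * (e (i+j+2) * K (i+j+2) (m+1))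
      = e (m+1) * (e (i+1) * K (i+1) (m+1)) := by
    intro i
    rw [ENNReal.tsum_mul_left]
    have := transport (i+1) m
    simp only [show ∀ k, i + 1 + k + 1 = i + k + 2 from fun k => by ring] at this
    rw [this]; ring
  simp_rw [h]
  rw [ENNReal.tsum_mul_left]
  have := transport 0 m
  simp only [zero_add] at this
  rw [this, K_zero']; ring

lemma SS_sum {ι : Type} (w : ι → ℝ≥0∞) (M : ι → ℕ) :
    ∑' i, ∑' j, e (i+1) * (e (i+j+2) * ∑' p, w p * K (i+j+2) (M p + 1))
      = ∑' p, w p * e (M p + 1) ^ 2 := by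
  simp_rw [← SS, ← ENNReal.tsum_mul_left]
  rw [ENNReal.tsum_comm]
  conv_lhs => rw [ENNReal.tsum_comm]
  have : ∀ i : ℕ, (∑' j : ℕ, ∑' p, e (i+1) * (e (i+j+2) * (w p * K (i+j+2) (M p + 1))))
     = ∑' p, ∑' j : ℕ, w p * (e (i+1) * (e (i+j+2) * K (i+j+2) (M p + 1))) := by
    intro i
    rw [ENNReal.tsum_comm]
    refine tsum_congr fun p => tsum_congr fun j => by ring
  simp_rw [this]
  rw [ENNReal.tsum_comm]

lemma D1 (n : ℕ) : e (n+1) = ∑' x, e (x+1) * K (n+1) (x+1) := by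
  have := transport' n 0
  simpa [K_zero] using this

lemma D3 (n : ℕ) : e (n+1) ^ 3 = ∑' p : ℕ × ℕ × ℕ,
    (e (p.1+1) * e (p.1+p.2.1+2) * e (p.1+p.2.1+p.2.2+3)) * K (n+1) (p.1+p.2.1+p.2.2+2+1) := by
  rw [ENNReal.tsum_prod']
  simp_rw [ENNReal.tsum_prod']
  have h1 : ∀ x y, ∑' z, (e (x+1) * e (x+y+2) * e (x+y+z+3)) * K (n+1) (x+y+z+2+1)
      = e (x+1) * e (x+y+2) * (e (n+1) * K (n+1) (x+y+2)) := by
    intro x y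
    rw [transport', ← ENNReal.tsum_mul_left]
    refine tsum_congr fun z => ?_
    rw [show x+y+2+z+1 = x+y+z+3 by ring]; ring
  have h2 : ∀ x, ∑' y, e (x+1) * e (x+y+2) * (e (n+1) * K (n+1) (x+y+2))
      = e (x+1) * (e (n+1) * (e (n+1) * K (n+1) (x+1))) := by
    intro x
    rw [transport', ← ENNReal.tsum_mul_left, ← ENNReal.tsum_mul_left]
    refine tsum_congr fun z => ?_
    rw [show x+1+z+1 = x+z+2 by ring]; ring
  simp_rw [h1, h2]
  calc e (n+1) ^ 3 = e (n+1) ^ 2 * e (n+1) := by ring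
    _ = e (n+1) ^ 2 * ∑' x, e (x+1) * K (n+1) (x+1) := by rw [← D1]
    _ = _ := by
      rw [← ENNReal.tsum_mul_left]
      exact tsum_congr fun x => by ring

lemma duality1 : Z2 1 4 = Z3 1 1 3 := by
  have h := SS_sum (fun p : ℕ × ℕ × ℕ => e (p.1+1) * e (p.1+p.2.1+2) * e (p.1+p.2.1+p.2.2+3))
    (fun p => p.1+p.2.1+p.2.2+2)
  simp only [← D3] at h
  unfold Z2 Z3
  calc _ = _ := ?_
    _ = _ := h
    _ = _ := ?_
  · exact tsum_congr fun i => tsum_congr fun j => by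
      rw [show i+j+1+1 = i+j+2 by ring]; ring
  · rw [ENNReal.tsum_prod']
    simp_rw [ENNReal.tsum_prod']
    exact tsum_congr fun i => tsum_congr fun j => tsum_congr fun k => by ring

lemma inner (n : ℕ) : ∑' k, e (n+k+1) ^ 2 = ∑' x, e (x+1) ^ 2 * K n (x+1) := by
  have : ∀ k, e (n+k+1) ^ 2 = ∑' x, e (x+1) * (e (n+k+1) * K (n+k+1) (x+1)) := by
    intro k
    rw [sq]
    nth_rewrite 2 [D1]
    rw [← ENNReal.tsum_mul_left]
    exact tsum_congr fun x => by ring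
  simp_rw [this]
  rw [ENNReal.tsum_comm]
  simp_rw [ENNReal.tsum_mul_left, transport]
  exact tsum_congr fun x => by ring

lemma D2' (n : ℕ) : e (n+1) * ∑' k, e (n+1+k+1) ^ 2 = ∑' p : ℕ × ℕ,
    (e (p.1+1) ^ 2 * e (p.1+p.2+2)) * K (n+1) (p.1+p.2+1+1) := by
  rw [inner, ENNReal.tsum_prod', ← ENNReal.tsum_mul_left]
  refine tsum_congr fun x => ?_
  rw [mul_left_comm, transport', ← ENNReal.tsum_mul_left]
  refine tsum_congr fun y => ?_
  rw [show x+1+y+1 = x+y+2 by ring]; ring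

lemma duality2 : Z3 1 2 2 = Z2 2 3 := by
  have h := SS_sum (fun p : ℕ × ℕ => e (p.1+1) ^ 2 * e (p.1+p.2+2)) (fun p => p.1+p.2+1)
  unfold Z2 Z3
  calc _ = _ := ?_
    _ = _ := h
    _ = _ := ?_
  · refine tsum_congr fun i => tsum_congr fun j => ?_
    have := D2' (i+j+1)
    rw [show i+j+2 = i+j+1+1 by ring, ← this, ENNReal.tsum_mul_left]
    simp only [show ∀ k, i+j+1+1+k+1 = i+j+k+3 from fun k => by ring]
    ring
  · rw [ENNReal.tsum_prod']
    exact tsum_congr fun i => tsum_congr fun j => by ring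

/-! double sums -/

lemma tsum_lt (h : ℕ → ℝ≥0∞) (i : ℕ) :
    ∑' j, (if i < j then h j else 0) = ∑' k, h (i+k+1) := by
  have hinj : Function.Injective (fun k : ℕ => i+k+1) := fun a b h => by simpa using h
  rw [← hinj.tsum_eq (f := fun j => if i < j then h j else 0)]
  · exact tsum_congr fun k => by rw [if_pos (by omega)]
  · intro j hj
    have : i < j := by
      by_contra hc
      simp [hc] at hj
    exact ⟨j - i - 1, by simp only; omega⟩

lemma split (g : ℕ → ℕ → ℝ≥0∞) : ∑' i, ∑' j, g i j =
    ∑' i, g i i + ∑' i, ∑' k, g i (i+k+1) + ∑' j, ∑' k, g (j+k+1) j := by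
  have h : ∀ i j, g i j = (if j = i then g i j else 0) + (if i < j then g i j else 0)
      + (if j < i then g i j else 0) := by
    intro i j
    rcases lt_trichotomy i j with h | h | h
    · simp [h, h.ne', h.not_gt]
    · simp [h]
    · simp [h, h.ne, h.not_gt]
  conv_lhs => enter [1, i, 1, j]; rw [h i j]
  simp_rw [ENNReal.tsum_add]
  congr 1
  · congr 1
    · exact tsum_congr fun i => by rw [tsum_ite_eq]
    · exact tsum_congr fun i => tsum_lt _ i
  · rw [ENNReal.tsum_comm]
    exact tsum_congr fun j => tsum_lt (fun i => g i j) j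

noncomputable def Z1 (p : ℕ) : ℝ≥0∞ := ∑' i : ℕ, e (i+1) ^ p

lemma prod_eq (p q : ℕ) : Z1 p * Z1 q = ∑' i, ∑' j, e (i+1) ^ p * e (j+1) ^ q := by
  unfold Z1
  rw [← ENNReal.tsum_mul_right]
  simp_rw [← ENNReal.tsum_mul_left]

lemma stuffle : Z1 2 * Z1 3 = Z1 5 + Z2 2 3 + Z2 3 2 := by
  rw [prod_eq, split]
  unfold Z1 Z2
  congr 1
  · congr 1
    exact tsum_congr fun i => by ring
  · exact tsum_congr fun i => tsum_congr fun j => by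
      rw [mul_comm]

lemma e_pow (n p : ℕ) : e n ^ p = ENNReal.ofReal (((n:ℝ)⁻¹) ^ p) := by
  unfold e; rw [ENNReal.ofReal_pow (by positivity)]

lemma Z2_comm (p q : ℕ) : Z2 p q = ∑' i : ℕ, ∑' j : ℕ, e (j+1) ^ p * e (i+j+2) ^ q := by
  unfold Z2
  rw [ENNReal.tsum_comm]
  exact tsum_congr fun i => tsum_congr fun j => by rw [add_comm i j]

/-- multiplicative helper -/
lemma ee (a b p q : ℕ) : e a ^ p * e b ^ q = ENNReal.ofReal ((a:ℝ)⁻¹ ^ p * (b:ℝ)⁻¹ ^ q) := by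
  rw [e_pow, e_pow, ENNReal.ofReal_mul (by positivity)]

lemma shuffle_pt (i j : ℕ) : e (i+1) ^ 2 * e (j+1) ^ 3 =
    (e (i+1) ^ 2 * e (i+j+2) ^ 3 + 3 * (e (i+1) ^ 1 * e (i+j+2) ^ 4)) +
    (e (j+1) ^ 3 * e (i+j+2) ^ 2 + 2 * (e (j+1) ^ 2 * e (i+j+2) ^ 3)
      + 3 * (e (j+1) ^ 1 * e (i+j+2) ^ 4)) := by
  simp_rw [ee]
  rw [show (3:ℝ≥0∞) = ENNReal.ofReal 3 by simp, show (2:ℝ≥0∞) = ENNReal.ofReal 2 by simp]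
  simp_rw [← ENNReal.ofReal_mul (show (0:ℝ) ≤ 3 by norm_num),
    ← ENNReal.ofReal_mul (show (0:ℝ) ≤ 2 by norm_num)]
  repeat rw [← ENNReal.ofReal_add (by positivity) (by positivity)]
  congr 1
  push_cast
  have h1 : (i + 1 : ℝ) ≠ 0 := by positivity
  have h2 : (j + 1 : ℝ) ≠ 0 := by positivity
  have h3 : (i + j + 2 : ℝ) ≠ 0 := by positivity
  field_simp
  ring

lemma shuffle : Z1 2 * Z1 3 = (Z2 2 3 + 3 * Z2 1 4) + (Z2 3 2 + 2 * Z2 2 3 + 3 * Z2 1 4) := by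
  rw [prod_eq]
  rw [tsum_congr fun i => tsum_congr fun j => shuffle_pt i j]
  simp_rw [ENNReal.tsum_add, ENNReal.tsum_mul_left]
  rw [← Z2_comm, ← Z2_comm, ← Z2_comm]
  unfold Z2
  simp_rw [ENNReal.tsum_mul_left]

lemma harm (a : ℕ) : ∑' j : ℕ, ENNReal.ofReal ((a:ℝ) * ((j+1:ℝ)⁻¹ * (a+j+1:ℝ)⁻¹))
    = ∑ k ∈ Finset.range a, e (k+1) := by
  induction a with
  | zero => simp
  | succ a ih =>
    rw [Finset.sum_range_succ, ← ih]
    have key := tsum_tele (fun k : ℕ => ((a:ℝ)+k+1)⁻¹) ?_ ?_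
    · have h2 : e (a+1) = ENNReal.ofReal (((a:ℝ)+(0:ℕ)+1)⁻¹) := by simp [e]
      rw [h2, ← key, ← ENNReal.tsum_add]
      refine tsum_congr fun j => ?_
      have h3 : 0 ≤ (↑a + ↑j + 1 : ℝ)⁻¹ - (↑a + ↑(j + 1) + 1 : ℝ)⁻¹ := by
        rw [sub_nonneg]; gcongr; simp
      rw [← ENNReal.ofReal_add (by positivity) h3]
      congr 1
      push_cast
      have h1 : (a + 1 + j + 1 : ℝ) ≠ 0 := by positivity
      have h1' : (a + (j + 1) + 1 : ℝ) ≠ 0 := by positivity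
      have h2 : (j + 1 : ℝ) ≠ 0 := by positivity
      have h3 : (a + j + 1 : ℝ) ≠ 0 := by positivity
      field_simp
      ring
    · intro k l hkl
      simp only
      gcongr
    · have h := (tendsto_one_div_add_atTop_nhds_zero_nat (𝕜 := ℝ)).comp (tendsto_add_atTop_nat a)
      refine h.congr fun k => ?_
      simp [add_comm]

lemma sum_pt (i j : ℕ) :
    e (i+1) ^ 1 * e (i+j+2) ^ 4 + e (i+1) ^ 2 * e (i+j+2) ^ 3 + e (i+1) ^ 3 * e (i+j+2) ^ 2
      + e (j+1) ^ 1 * e (i+j+2) ^ 4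
    = e (i+1) ^ 4 * ENNReal.ofReal (((i+1:ℕ):ℝ) * ((j+1:ℝ)⁻¹ * ((i+1:ℕ)+j+1:ℝ)⁻¹)) := by
  simp_rw [ee]
  rw [e_pow, ← ENNReal.ofReal_mul (by positivity)]
  repeat rw [← ENNReal.ofReal_add (by positivity) (by positivity)]
  congr 1
  push_cast
  have h1 : (i + 1 : ℝ) ≠ 0 := by positivity
  have h2 : (j + 1 : ℝ) ≠ 0 := by positivity
  have h3 : (i + j + 2 : ℝ) ≠ 0 := by positivity
  rw [show (i + 1 + j + 1 : ℝ) = i + j + 2 by ring]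
  field_simp
  ring

lemma Z14_harm : Z2 1 4 = ∑' i, e (i+1) ^ 4 * ∑ k ∈ Finset.range i, e (k+1) := by
  unfold Z2
  have : ∀ i, ∑' j, e (i+1) ^ 1 * e (i+j+2) ^ 4
      = ∑' j, if i < j then e (i+1) * e (j+1) ^ 4 else 0 := by
    intro i
    rw [tsum_lt (fun j => e (i+1) * e (j+1) ^ 4)]
    simp only [pow_one]
  simp_rw [this]
  rw [ENNReal.tsum_comm]
  refine tsum_congr fun j => ?_
  rw [tsum_eq_sum (s := Finset.range j), Finset.mul_sum]
  · refine Finset.sum_congr rfl fun k hk => ?_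
    rw [if_pos (Finset.mem_range.1 hk), mul_comm]
  · intro k hk
    rw [if_neg (by simpa using hk)]

lemma sum_formula : Z2 1 4 + Z2 2 3 + Z2 3 2 + Z2 1 4 = Z2 1 4 + Z1 5 := by
  have h : ∑' i, ∑' j, (e (i+1) ^ 1 * e (i+j+2) ^ 4 + e (i+1) ^ 2 * e (i+j+2) ^ 3
      + e (i+1) ^ 3 * e (i+j+2) ^ 2 + e (j+1) ^ 1 * e (i+j+2) ^ 4)
      = Z2 1 4 + Z1 5 := by
    simp_rw [sum_pt, ENNReal.tsum_mul_left, harm, Finset.sum_range_succ, mul_add,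
      ENNReal.tsum_add]
    rw [← Z14_harm]
    unfold Z1
    congr 1
  rw [← h]
  simp_rw [ENNReal.tsum_add]
  rw [← Z2_comm]
  rfl

lemma Z1_fin (p : ℕ) (hp : 1 < p) : Z1 p ≠ ⊤ := by
  unfold Z1
  simp_rw [e_pow]
  have hs : Summable (fun i : ℕ => (((i+1 : ℕ) : ℝ)⁻¹) ^ p) := by
    have := (summable_nat_add_iff 1).2 (Real.summable_nat_pow_inv.2 hp)
    simpa [inv_pow] using this
  rw [← ENNReal.ofReal_tsum_of_nonneg (fun i => by positivity) hs]
  exact ENNReal.ofReal_ne_top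

lemma e_toReal (n : ℕ) : (e n).toReal = (n:ℝ)⁻¹ := by
  unfold e; rw [ENNReal.toReal_ofReal (by positivity)]

lemma e_ne_top (n : ℕ) : e n ≠ ⊤ := ENNReal.ofReal_ne_top

def eq2 : ℕ × ℕ ≃ {f : Fin 2 → ℕ+ // StrictMono f} where
  toFun p := ⟨![⟨p.1+1, by omega⟩, ⟨p.1+p.2+2, by omega⟩], by
    rw [Fin.strictMono_iff_lt_succ]
    intro i
    rw [← PNat.coe_lt_coe]
    fin_cases i
    simp⟩
  invFun f := ((f.1 0 : ℕ) - 1, (f.1 1 : ℕ) - (f.1 0 : ℕ) - 1)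
  left_inv p := by
    ext <;> simp <;> omega
  right_inv f := by
    have h : (f.1 0 : ℕ) < f.1 1 := f.2 (by decide)
    have h0 := (f.1 0).pos
    apply Subtype.ext
    funext i
    apply PNat.eq
    fin_cases i <;> simp <;> omega

def eq3 : ℕ × ℕ × ℕ ≃ {f : Fin 3 → ℕ+ // StrictMono f} where
  toFun p := ⟨![⟨p.1+1, by omega⟩, ⟨p.1+p.2.1+2, by omega⟩, ⟨p.1+p.2.1+p.2.2+3, by omega⟩], by
    rw [Fin.strictMono_iff_lt_succ]
    intro i
    rw [← PNat.coe_lt_coe]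
    fin_cases i <;> simp⟩
  invFun f := ((f.1 0 : ℕ) - 1, (f.1 1 : ℕ) - (f.1 0 : ℕ) - 1, (f.1 2 : ℕ) - (f.1 1 : ℕ) - 1)
  left_inv p := by
    ext <;> simp <;> omega
  right_inv f := by
    have h : (f.1 0 : ℕ) < f.1 1 := f.2 (by decide)
    have h' : (f.1 1 : ℕ) < f.1 2 := f.2 (by decide)
    have h0 := (f.1 0).pos
    apply Subtype.ext
    funext i
    apply PNat.eq
    fin_cases i <;> simp <;> omega

lemma mzv2 (p q : ℕ) : mzv [p, q] = (Z2 p q).toReal := by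
  unfold mzv Z2
  rw [← ENNReal.tsum_prod (f := fun i j => e (i+1) ^ p * e (i+j+2) ^ q), ENNReal.tsum_toReal_eq]
  · refine (Equiv.tsum_eq eq2 _).symm.trans ?_
    refine tsum_congr fun x => ?_
    refine (Fin.prod_univ_two _).trans ?_
    simp [eq2, ENNReal.toReal_mul, ENNReal.toReal_pow, e_toReal]
  · intro x
    exact ENNReal.mul_ne_top (ENNReal.pow_ne_top (e_ne_top _)) (ENNReal.pow_ne_top (e_ne_top _))

lemma mzv3 (p q r : ℕ) : mzv [p, q, r] = (Z3 p q r).toReal := by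
  have hZ : Z3 p q r = ∑' x : ℕ × ℕ × ℕ,
      e (x.1+1) ^ p * e (x.1+x.2.1+2) ^ q * e (x.1+x.2.1+x.2.2+3) ^ r := by
    rw [ENNReal.tsum_prod']
    simp_rw [ENNReal.tsum_prod']
    rfl
  rw [hZ, ENNReal.tsum_toReal_eq]
  · unfold mzv
    refine (Equiv.tsum_eq eq3 _).symm.trans ?_
    refine tsum_congr fun x => ?_
    refine (Fin.prod_univ_three _).trans ?_
    simp [eq3, ENNReal.toReal_mul, ENNReal.toReal_pow, e_toReal]
  · intro x
    exact ENNReal.mul_ne_top (ENNReal.mul_ne_top (ENNReal.pow_ne_top (e_ne_top _))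
      (ENNReal.pow_ne_top (e_ne_top _))) (ENNReal.pow_ne_top (e_ne_top _))

end MZVProof

open MZVProof in
theorem mzv_rel_8 : 6 * mzv [1,4] - mzv [3,2] - mzv [1,1,3] + mzv [1,2,2] = 0 := by
  rw [mzv2, mzv2, mzv3, mzv3, ← duality1, duality2]
  have hP : Z1 2 * Z1 3 ≠ ⊤ := ENNReal.mul_ne_top (Z1_fin 2 (by norm_num)) (Z1_fin 3 (by norm_num))
  have hst := stuffle
  have hsh := shuffle
  have hsum := sum_formula
  have f := hP
  rw [hsh] at f
  have f14 : Z2 1 4 ≠ ⊤ := by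
    intro h; rw [h] at f; simp at f
  have f23 : Z2 2 3 ≠ ⊤ := by
    intro h; rw [h] at f; simp at f
  have f32 : Z2 3 2 ≠ ⊤ := by
    intro h; rw [h] at f; simp at f
  have f5 : Z1 5 ≠ ⊤ := Z1_fin 5 (by norm_num)
  rw [hst] at hsh
  lift Z2 1 4 to NNReal using f14 with a
  lift Z2 2 3 to NNReal using f23 with b
  lift Z2 3 2 to NNReal using f32 with c
  lift Z1 5 to NNReal using f5 with d
  have e1 : (d + b + c : ℝ) = (b + 3 * a) + (c + 2 * b + 3 * a) := by exact_mod_cast hsh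
  have e2 : (a + b + c + a : ℝ) = a + d := by exact_mod_cast hsum
  simp only [ENNReal.coe_toReal]
  linarith
end

section
/- The weight-5 multiple zeta values satisfy 4ζ(1,4) = 2ζ(2,1,2) − ζ(1,1,1,2). -/
open scoped ENNReal Topology

namespace MZV10

noncomputable def w (a : ℕ) : ℝ≥0∞ := ENNReal.ofReal ((a : ℝ)⁻¹)

noncomputable def S (m : ℕ) (f : ℕ → ℝ≥0∞) : ℝ≥0∞ := ∑' d : ℕ, f (m + d + 1)

noncomputable def D (m n : ℕ) : ℝ≥0∞ := ENNReal.ofReal (((m + n).choose m : ℝ)⁻¹)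

noncomputable def Z : ℕ → List ℕ → ℝ≥0∞
  | _, [] => 1
  | m, k :: ks => S m (fun a => w a ^ k * Z a ks)

lemma S_comm (m n : ℕ) (f : ℕ → ℕ → ℝ≥0∞) :
    S m (fun a => S n (fun b => f a b)) = S n (fun b => S m (fun a => f a b)) := by
  unfold S; exact ENNReal.tsum_comm

lemma S_mul_left (m : ℕ) (c : ℝ≥0∞) (f : ℕ → ℝ≥0∞) :
    S m (fun a => c * f a) = c * S m f := by
  unfold S; exact ENNReal.tsum_mul_left

lemma S_add (m : ℕ) (f g : ℕ → ℝ≥0∞) :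
    S m (fun a => f a + g a) = S m f + S m g := by
  unfold S; exact ENNReal.tsum_add

lemma S_congr (m : ℕ) {f g : ℕ → ℝ≥0∞} (h : ∀ a, m < a → f a = g a) : S m f = S m g := by
  unfold S; exact tsum_congr fun d => h _ (by omega)

lemma tele (f u : ℕ → ℝ≥0∞) (h : ∀ d, f d + u (d + 1) = u d)
    (hu : Filter.Tendsto u Filter.atTop (𝓝 0)) : ∑' d, f d = u 0 := by
  have h1 : ∀ N, ∑ d ∈ Finset.range N, f d + u N = u 0 := by
    intro N
    induction N with
    | zero => simp
    | succ N ih => rw [Finset.sum_range_succ, add_assoc, h, ih]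
  have h2 : Filter.Tendsto (fun N => ∑ d ∈ Finset.range N, f d + u N) Filter.atTop
      (𝓝 (∑' d, f d + 0)) := (ENNReal.tendsto_nat_tsum f).add hu
  simp only [h1, add_zero] at h2
  exact tendsto_nhds_unique h2 tendsto_const_nhds

lemma w_tendsto (c : ℕ) : Filter.Tendsto (fun d => w (d + c)) Filter.atTop (𝓝 0) := by
  have := ENNReal.tendsto_ofReal
    ((tendsto_inv_atTop_nhds_zero_nat (𝕜 := ℝ)).comp (Filter.tendsto_add_atTop_nat c))
  simpa [w] using this

lemma w_ne_top (a : ℕ) : w a ≠ ⊤ := ENNReal.ofReal_ne_top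

lemma D_symm (m n : ℕ) : D m n = D n m := by
  unfold D; rw [Nat.choose_symm_add, add_comm]

lemma D_zero_right (m : ℕ) : D m 0 = 1 := by simp [D]

lemma D_le (m n : ℕ) (hn : 0 < n) : D m n ≤ w (m + 1) := by
  unfold D w
  apply ENNReal.ofReal_le_ofReal
  apply inv_anti₀ (by positivity)
  have h : (m + 1).choose m ≤ (m + n).choose m := Nat.choose_le_choose _ (by omega)
  rw [Nat.choose_succ_self_right] at h
  exact_mod_cast h

lemma D_step (m n : ℕ) (hn : 0 < n) :
    w (m + 1) * D (m + 1) n + w n * D (m + 1) n = w n * D m n := by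
  unfold D w
  rw [← ENNReal.ofReal_mul (by positivity), ← ENNReal.ofReal_mul (by positivity),
    ← ENNReal.ofReal_mul (by positivity), ← ENNReal.ofReal_add (by positivity) (by positivity)]
  congr 1
  have h := Nat.add_one_mul_choose_eq (m + n) m
  have h' : ((m + n + 1 : ℕ) : ℝ) * ((m + n).choose m : ℝ)
    = ((m + n + 1).choose (m + 1) : ℝ) * ((m + 1 : ℕ) : ℝ) := by exact_mod_cast h
  have e : m + 1 + n = m + n + 1 := by ring
  rw [e]
  have p1 : (0 : ℝ) < (m + n).choose m := by exact_mod_cast Nat.choose_pos (by omega)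
  have p2 : (0 : ℝ) < (m + n + 1).choose (m + 1) := by exact_mod_cast Nat.choose_pos (by omega)
  have p3 : (0 : ℝ) < n := by exact_mod_cast hn
  push_cast at h' ⊢
  field_simp
  linarith

lemma transport (m n : ℕ) (hn : 0 < n) : S m (fun a => w a * D a n) = w n * D m n := by
  unfold S
  have := tele (fun d => w (m + d + 1) * D (m + d + 1) n) (fun d => w n * D (m + d) n)
    (fun d => D_step (m + d) n hn) ?_
  · simpa using this
  · have h0 : Filter.Tendsto (fun d => D (m + d) n) Filter.atTop (𝓝 0) := by
      refine tendsto_of_tendsto_of_tendsto_of_le_of_le tendsto_const_nhds (w_tendsto (m + 1))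
        (fun _ => zero_le) (fun d => ?_)
      have := D_le (m + d) n hn
      rwa [show m + d + 1 = d + (m + 1) by ring] at this
    simpa using ENNReal.Tendsto.const_mul h0 (Or.inr (w_ne_top n))

lemma transport' (m n : ℕ) (hn : 0 < n) : S m (fun a => w a * D n a) = w n * D n m := by
  have := transport m n hn
  simpa only [D_symm n] using this

/-- move one factor: `Σ_{n>0} n^{-(j+1)} D(n,b) = Σ_{c>b} c^{-1} Σ_{n>0} n^{-j} D(n,c)`. -/
lemma move (m b j : ℕ) (g : ℕ → ℝ≥0∞) :
    S m (fun n => g n * w n ^ (j + 1) * D n b)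
      = S b (fun c => w c * S m (fun n => g n * w n ^ j * D n c)) := by
  have : ∀ n, m < n → g n * w n ^ (j + 1) * D n b
      = S b (fun c => w c * (g n * w n ^ j * D n c)) := by
    intro n hn
    have h := transport' b n (by omega)
    calc g n * w n ^ (j + 1) * D n b = (g n * w n ^ j) * (w n * D n b) := by ring
      _ = S b (fun c => (g n * w n ^ j) * (w c * D n c)) := by rw [← h, S_mul_left]
      _ = _ := by congr 1; funext c; ring
  rw [S_congr m this, S_comm]
  simp only [S_mul_left]

lemma finish (b : ℕ) (hb : 0 < b) : S 0 (fun n => 1 * w n ^ 1 * D n b) = w b := by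
  have h := transport 0 b hb
  have e : D 0 b = 1 := by rw [D_symm, D_zero_right]
  simpa [e] using h

lemma dual5 : Z 0 [5] = Z 0 [1, 1, 1, 2] := by
  have h0 : Z 0 [5] = S 0 (fun n => 1 * w n ^ (4 + 1) * D n 0) := by simp [Z, D_zero_right]
  rw [h0, move]
  simp only [Z, pow_one, mul_one]
  refine S_congr _ fun a ha => ?_
  rw [move 0 a 3]
  congr 1
  refine S_congr _ fun b hb => ?_
  rw [move 0 b 2]
  congr 1
  refine S_congr _ fun c hc => ?_
  rw [move 0 c 1]
  congr 1
  refine S_congr _ fun d hd => ?_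
  rw [finish d (by omega), sq]

lemma dual32 : Z 0 [3, 2] = Z 0 [2, 1, 2] := by
  have h0 : Z 0 [3, 2] = S 0 (fun b => w b * S 0 (fun n => w n ^ 3 *
      S n (fun m => w m * D m b))) := by
    simp only [Z, mul_one]
    have : ∀ n, 0 < n → w n ^ 3 * S n (fun m => w m ^ 2)
        = S 0 (fun b => w b * (w n ^ 3 * S n (fun m => w m * D m b))) := by
      intro n _
      have h := move n 0 1 (fun _ => 1)
      simp only [D_zero_right, one_mul, mul_one, pow_one] at h
      rw [show (1 + 1) = 2 from rfl] at h
      rw [h, ← S_mul_left]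
      congr 1; funext b; ring
    rw [S_congr 0 this, S_comm]
    simp only [S_mul_left]
  rw [h0]
  simp only [Z, pow_one, mul_one]
  refine S_congr _ fun a ha => ?_
  have h1 : S 0 (fun n => w n ^ 3 * S n (fun m => w m * D m a))
      = w a * S 0 (fun n => 1 * w n ^ (2 + 1) * D n a) := by
    rw [← S_mul_left]
    refine S_congr _ fun n hn => ?_
    rw [transport n a ha]; ring
  rw [h1, ← mul_assoc, ← sq, move 0 a 2]
  congr 1
  refine S_congr _ fun b hb => ?_
  rw [move 0 b 1]
  congr 1
  refine S_congr _ fun c hc => ?_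
  rw [finish c (by omega), sq]

lemma pf (a b : ℕ) (ha : 0 < a) (hb : 0 < b) :
    w a * w b = w (a + b) * (w a + w b) := by
  unfold w
  have h1 : (0 : ℝ) < a := by exact_mod_cast ha
  have h2 : (0 : ℝ) < b := by exact_mod_cast hb
  rw [← ENNReal.ofReal_add (by positivity) (by positivity),
    ← ENNReal.ofReal_mul (by positivity), ← ENNReal.ofReal_mul (by positivity)]
  congr 1
  push_cast
  field_simp
  ring

lemma alg_shuffle (X Y Z : ℝ≥0∞) (h : X * Y = Z * (X + Y)) :
    X ^ 2 * Y ^ 3 = X ^ 2 * Z ^ 3 + 3 * (X * Z ^ 4) + 3 * (Y * Z ^ 4) + Y ^ 3 * Z ^ 2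
      + 2 * (Y ^ 2 * Z ^ 3) := by
  have a1 : X ^ 2 * Y = Z * X ^ 2 + Z ^ 2 * X + Z ^ 2 * Y := by
    calc X ^ 2 * Y = X * (X * Y) := by ring
      _ = X * (Z * (X + Y)) := by rw [h]
      _ = Z * X ^ 2 + Z * (X * Y) := by ring
      _ = _ := by rw [h]; ring
  have a2 : X ^ 2 * Y ^ 2 = Z ^ 2 * (X ^ 2 + Y ^ 2) + 2 * Z ^ 3 * (X + Y) := by
    calc X ^ 2 * Y ^ 2 = X ^ 2 * Y * Y := by ring
      _ = (Z * X ^ 2 + Z ^ 2 * X + Z ^ 2 * Y) * Y := by rw [a1]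
      _ = Z * (X ^ 2 * Y) + Z ^ 2 * (X * Y) + Z ^ 2 * Y ^ 2 := by ring
      _ = _ := by rw [a1, h]; ring
  calc X ^ 2 * Y ^ 3 = X ^ 2 * Y ^ 2 * Y := by ring
    _ = Z ^ 2 * (X ^ 2 * Y) + Z ^ 2 * Y ^ 3 + 2 * Z ^ 3 * (X * Y) + 2 * Z ^ 3 * Y ^ 2 := by
      rw [a2]; ring
    _ = _ := by rw [a1, h]; ring

lemma alg_sum (X Y Z : ℝ≥0∞) (h : X * Y = Z * (X + Y)) :
    X ^ 3 * Z ^ 2 + X ^ 2 * Z ^ 3 + X * Z ^ 4 + Y * Z ^ 4 = X ^ 3 * (Y * Z) := by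
  symm
  calc X ^ 3 * (Y * Z) = X ^ 2 * Z * (X * Y) := by ring
    _ = X ^ 2 * Z * (Z * (X + Y)) := by rw [h]
    _ = Z ^ 2 * X ^ 3 + Z ^ 2 * X * (X * Y) := by ring
    _ = Z ^ 2 * X ^ 3 + Z ^ 2 * X * (Z * (X + Y)) := by rw [h]
    _ = Z ^ 2 * X ^ 3 + Z ^ 3 * X ^ 2 + Z ^ 3 * (X * Y) := by ring
    _ = _ := by rw [h]; ring

lemma Z2 (i j : ℕ) : Z 0 [i, j] = S 0 (fun a => S 0 (fun b => w a ^ i * w (a + b) ^ j)) := by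
  simp only [Z, mul_one]
  congr 1; funext a
  rw [S_mul_left]
  congr 1
  unfold S
  refine tsum_congr fun d => ?_
  show w (a + d + 1) ^ j = w (a + (0 + d + 1)) ^ j
  rw [show a + (0 + d + 1) = a + d + 1 by ring]

lemma Z2' (i j : ℕ) : Z 0 [i, j] = S 0 (fun a => S 0 (fun b => w b ^ i * w (a + b) ^ j)) := by
  rw [S_comm, Z2]
  simp only [add_comm]

lemma Z1 (i : ℕ) : Z 0 [i] = S 0 (fun a => w a ^ i) := by simp [Z]

lemma prod_eq (i j : ℕ) :
    Z 0 [i] * Z 0 [j] = S 0 (fun a => S 0 (fun b => w a ^ i * w b ^ j)) := by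
  simp only [S_mul_left, Z1]
  rw [mul_comm, ← S_mul_left]
  congr 1; funext a; ring

lemma shuffle : Z 0 [2] * Z 0 [3] = Z 0 [2, 3] + 3 * Z 0 [1, 4] + 3 * Z 0 [1, 4] + Z 0 [3, 2]
    + 2 * Z 0 [2, 3] := by
  rw [prod_eq]
  have : ∀ a, 0 < a → S 0 (fun b => w a ^ 2 * w b ^ 3) = S 0 (fun b =>
      w a ^ 2 * w (a + b) ^ 3 + 3 * (w a ^ 1 * w (a + b) ^ 4) + 3 * (w b ^ 1 * w (a + b) ^ 4)
       + w b ^ 3 * w (a + b) ^ 2 + 2 * (w b ^ 2 * w (a + b) ^ 3)) := by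
    intro a ha
    refine S_congr _ fun b hb => ?_
    simpa using alg_shuffle _ _ _ (pf a b ha hb)
  rw [S_congr _ this]
  simp only [S_add]
  rw [← Z2 2 3, ← Z2' 3 2]
  have c : ∀ (c : ℝ≥0∞) (f : ℕ → ℕ → ℝ≥0∞), S 0 (fun a => S 0 (fun b => c * f a b))
      = c * S 0 (fun a => S 0 (fun b => f a b)) := by
    intro c f; simp only [S_mul_left]
  rw [c, c, c, ← Z2 1 4, ← Z2' 1 4, ← Z2' 2 3]

lemma swap (F : ℕ → ℕ → ℝ≥0∞) :
    ∑' n, ∑ j ∈ Finset.range (n + 1), F n j = ∑' j, ∑' d, F (j + d) j := by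
  have h1 : ∀ n, ∑ j ∈ Finset.range (n + 1), F n j = ∑' j, if j ≤ n then F n j else 0 := by
    intro n
    rw [tsum_eq_sum (s := Finset.range (n + 1))]
    · refine Finset.sum_congr rfl fun j hj => ?_
      rw [if_pos (by simpa [Nat.lt_succ_iff] using hj)]
    · intro j hj
      rw [if_neg (by simpa [Nat.lt_succ_iff] using hj)]
  simp only [h1]
  rw [ENNReal.tsum_comm]
  refine tsum_congr fun j => ?_
  rw [← (ENNReal.summable).sum_add_tsum_nat_add' (k := j), Finset.sum_eq_zero, zero_add]
  · refine tsum_congr fun d => ?_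
    rw [if_pos (by omega), add_comm]
  · intro n hn
    rw [if_neg (by simpa using hn)]

/-- `Σ_{n} Σ_{j ≤ n} = diagonal + Σ_{j<n}`. -/
lemma swap' (F : ℕ → ℕ → ℝ≥0∞) :
    S 0 (fun n => ∑ j ∈ Finset.range n, F n (j + 1))
      = S 0 (fun n => F n n) + S 0 (fun j => S j (fun n => F n j)) := by
  unfold S
  simp only [zero_add]
  rw [swap (fun n j => F (n + 1) (j + 1)), ← ENNReal.tsum_add]
  refine tsum_congr fun j => ?_
  rw [tsum_eq_zero_add' ENNReal.summable]
  congr 1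
  refine tsum_congr fun d => ?_
  congr 1; ring

lemma stuffle : Z 0 [2] * Z 0 [3] = Z 0 [5] + Z 0 [3, 2] + Z 0 [2, 3] := by
  rw [prod_eq]
  have : ∀ a, S 0 (fun b => w a ^ 2 * w b ^ 3) = ∑ j ∈ Finset.range a, w a ^ 2 * w (j + 1) ^ 3
      + S a (fun b => w a ^ 2 * w b ^ 3) := by
    intro a
    unfold S
    rw [← (ENNReal.summable).sum_add_tsum_nat_add' (k := a)]
    simp only [zero_add]
    congr 1
    refine tsum_congr fun d => ?_
    rw [add_comm d a]
  simp only [this]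
  rw [S_add, swap' (fun a b => w a ^ 2 * w b ^ 3)]
  congr 1
  · congr 1
    · rw [Z1]; congr 1; funext a; ring
    · simp only [Z, mul_one]
      congr 1; funext a
      rw [← S_mul_left]; congr 1; funext b; ring
  · simp only [Z, mul_one, S_mul_left]

lemma harm (n : ℕ) (hn : 0 < n) :
    S 0 (fun k => w k * w (n + k)) = w n * ∑ j ∈ Finset.range n, w (j + 1) := by
  have := tele (fun d => w (d + 1) * w (n + (d + 1)))
    (fun d => w n * ∑ j ∈ Finset.range n, w (d + (j + 1))) ?_ ?_
  · simpa [S] using this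
  · intro d
    have e : ∑ j ∈ Finset.range n, w (d + 1 + (j + 1)) + w (d + 1)
        = ∑ j ∈ Finset.range n, w (d + (j + 1)) + w (n + (d + 1)) := by
      have a := Finset.sum_range_succ (fun j => w (d + (j + 1))) n
      have b := Finset.sum_range_succ' (fun j => w (d + (j + 1))) n
      rw [show n + (d + 1) = d + (n + 1) by ring, ← a, b]
      simp only [zero_add]
      congr 1
      refine Finset.sum_congr rfl fun j _ => ?_
      congr 1; ring
    have p := pf n (d + 1) hn (by omega)
    -- cancel `w n * w (n+d+1)`
    have hfin : w n * w (n + (d + 1)) ≠ ⊤ := ENNReal.mul_ne_top (w_ne_top _) (w_ne_top _)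
    refine (ENNReal.add_left_inj hfin).1 ?_
    calc _ = w n * ∑ j ∈ Finset.range n, w (d + 1 + (j + 1))
            + w (n + (d + 1)) * (w n + w (d + 1)) := by ring
      _ = w n * (∑ j ∈ Finset.range n, w (d + 1 + (j + 1)) + w (d + 1)) := by rw [← p]; ring
      _ = _ := by rw [e]; ring
  · have h0 : Filter.Tendsto (fun d => ∑ j ∈ Finset.range n, w (d + (j + 1))) Filter.atTop
        (𝓝 (∑ j ∈ Finset.range n, 0)) := tendsto_finsetSum _ fun j _ => w_tendsto (j + 1)
    simpa using ENNReal.Tendsto.const_mul h0 (Or.inr (w_ne_top n))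

lemma sumformula : Z 0 [3, 2] + Z 0 [2, 3] + Z 0 [1, 4] + Z 0 [1, 4] = Z 0 [5] + Z 0 [1, 4] := by
  have h1 : Z 0 [3, 2] + Z 0 [2, 3] + Z 0 [1, 4] + Z 0 [1, 4]
      = S 0 (fun a => S 0 (fun b => w a ^ 3 * (w b * w (a + b)))) := by
    nth_rewrite 2 [Z2' 1 4]
    rw [Z2 3 2, Z2 2 3, Z2 1 4]
    simp only [← S_add]
    refine S_congr _ fun a ha => S_congr _ fun b hb => ?_
    simpa using alg_sum _ _ _ (pf a b ha hb)
  rw [h1]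
  have h2 : S 0 (fun a => S 0 (fun b => w a ^ 3 * (w b * w (a + b))))
      = S 0 (fun a => ∑ j ∈ Finset.range a, w a ^ 4 * w (j + 1)) := by
    refine S_congr _ fun a ha => ?_
    rw [S_mul_left, harm a ha, ← Finset.mul_sum]; ring
  rw [h2, swap' (fun a b => w a ^ 4 * w b)]
  congr 1
  · rw [Z1]; congr 1
  · simp only [Z, mul_one, pow_one]
    congr 1; funext a
    rw [← S_mul_left]; congr 1; funext b; exact mul_comm _ _

lemma Z1_ne_top (i : ℕ) (hi : 1 < i) : Z 0 [i] ≠ ⊤ := by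
  rw [Z1]
  unfold S w
  have hs : Summable (fun d : ℕ => (((d + 1 : ℕ) : ℝ) ^ i)⁻¹) :=
    (summable_nat_add_iff 1).2 (Real.summable_nat_pow_inv.2 hi)
  have := hs.tsum_ofReal_ne_top
  convert this using 4 with d
  show ENNReal.ofReal (((0 + d + 1 : ℕ) : ℝ)⁻¹) ^ i = _
  rw [← ENNReal.ofReal_pow (by positivity), zero_add, inv_pow]

/-- Prepend an entry. -/
def pcons {r : ℕ} (a : ℕ+) (f : Fin r → ℕ+) : Fin (r + 1) → ℕ+ :=
  Fin.cons (α := fun _ => ℕ+) a f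

lemma pcons_zero {r : ℕ} (a : ℕ+) (f : Fin r → ℕ+) : pcons a f 0 = a := rfl

lemma pcons_succ {r : ℕ} (a : ℕ+) (f : Fin r → ℕ+) (i : Fin r) : pcons a f i.succ = f i := rfl

/-- Splitting off the smallest entry. -/
def splitEquiv (r m : ℕ) :
    {f : Fin (r + 1) → ℕ+ // StrictMono f ∧ ∀ i, m < (f i : ℕ)} ≃
      (Σ d : ℕ, {f : Fin r → ℕ+ // StrictMono f ∧ ∀ i, m + d + 1 < (f i : ℕ)}) where
  toFun f := ⟨(f.1 0 : ℕ) - m - 1, fun i => f.1 i.succ, by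
      refine ⟨fun i j hij => f.2.1 (Fin.succ_lt_succ_iff.2 hij), fun i => ?_⟩
      have h := f.2.2 0
      have h2 : (f.1 0 : ℕ) < f.1 i.succ := f.2.1 (Fin.succ_pos i)
      show m + ((f.1 0 : ℕ) - m - 1) + 1 < (f.1 i.succ : ℕ)
      omega⟩
  invFun p := ⟨pcons (Nat.succPNat (m + p.1)) p.2.1, by
      refine ⟨?_, ?_⟩
      · intro i j hij
        induction j using Fin.cases with
        | zero => exact absurd hij (Fin.not_lt_zero i)
        | succ j =>
          induction i using Fin.cases with
          | zero =>
            rw [pcons_zero, pcons_succ]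
            exact p.2.2.2 j
          | succ i =>
            rw [pcons_succ, pcons_succ]
            exact p.2.2.1 (Fin.succ_lt_succ_iff.1 hij)
      · intro i
        induction i using Fin.cases with
        | zero => rw [pcons_zero, Nat.succPNat_coe]; omega
        | succ i =>
          rw [pcons_succ]
          have := p.2.2.2 i
          omega⟩
  left_inv f := by
    apply Subtype.ext
    funext i
    induction i using Fin.cases with
    | zero =>
      have h := f.2.2 0
      apply PNat.eq
      simp only [pcons_zero, Nat.succPNat_coe]
      omega
    | succ i => simp only [pcons_succ]
  right_inv p := by
    obtain ⟨d, f, hf⟩ := p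
    have e : ((Nat.succPNat (m + d) : ℕ+) : ℕ) - m - 1 = d := by
      rw [Nat.succPNat_coe]; omega
    refine Sigma.ext ?_ ?_
    · exact e
    · refine (Subtype.heq_iff_coe_eq ?_).2 ?_
      · intro g
        simp only [pcons_zero, e]
      · funext i
        simp only [pcons_succ]

lemma tsum_eq_Z (k : List ℕ) : ∀ m : ℕ,
    ∑' f : {f : Fin k.length → ℕ+ // StrictMono f ∧ ∀ i, m < (f i : ℕ)},
      ∏ i : Fin k.length, w (f.1 i : ℕ) ^ (k.get i) = Z m k := by
  induction k with
  | nil =>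
    intro m
    have : Unique {f : Fin ([] : List ℕ).length → ℕ+ // StrictMono f ∧ ∀ i, m < (f i : ℕ)} :=
      { default := ⟨fun i => i.elim0, fun i => i.elim0, fun i => i.elim0⟩
        uniq := fun f => Subtype.ext (funext fun i => i.elim0) }
    rw [tsum_eq_single default (fun b hb => absurd (Subsingleton.elim _ _) hb)]
    simp [Z]
  | cons k ks ih =>
    intro m
    have h := (splitEquiv ks.length m).symm.tsum_eq
      (fun f => ∏ i : Fin (ks.length + 1), w (f.1 i : ℕ) ^ ((k :: ks).get i))
    refine h.symm.trans ?_
    rw [ENNReal.tsum_sigma']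
    simp only [Z, S]
    refine tsum_congr fun d => ?_
    rw [← ih, ← ENNReal.tsum_mul_left]
    refine tsum_congr fun f => ?_
    rw [Fin.prod_univ_succ]
    rfl

lemma mzv_eq (k : List ℕ) : mzv k = (Z 0 k).toReal := by
  rw [← tsum_eq_Z, ENNReal.tsum_toReal_eq]
  · unfold mzv
    let e : {f : Fin k.length → ℕ+ // StrictMono f} ≃
        {f : Fin k.length → ℕ+ // StrictMono f ∧ ∀ i, 0 < (f i : ℕ)} :=
      Equiv.subtypeEquivRight fun f => ⟨fun h => ⟨h, fun i => (f i).pos⟩, fun h => h.1⟩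
    rw [← e.tsum_eq]
    refine tsum_congr fun f => ?_
    rw [ENNReal.toReal_prod]
    refine Finset.prod_congr rfl fun i _ => ?_
    rw [ENNReal.toReal_pow, w, ENNReal.toReal_ofReal (by positivity), inv_pow]
    rfl
  · intro f
    exact ENNReal.prod_ne_top fun i _ => ENNReal.pow_ne_top (w_ne_top _)

end MZV10

open MZV10 in
theorem mzv_rel_10 : 4 * mzv [1,4] = 2 * mzv [2,1,2] - mzv [1,1,1,2] := by
  simp only [mzv_eq]
  rw [← dual5, ← dual32]
  have hfin : Z 0 [2] * Z 0 [3] ≠ ⊤ :=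
    ENNReal.mul_ne_top (Z1_ne_top 2 (by norm_num)) (Z1_ne_top 3 (by norm_num))
  have h5 : Z 0 [5] ≠ ⊤ := Z1_ne_top 5 (by norm_num)
  have h32 : Z 0 [3, 2] ≠ ⊤ := by
    refine ne_top_of_le_ne_top hfin ?_
    rw [stuffle]; exact le_add_right le_add_self
  have h23 : Z 0 [2, 3] ≠ ⊤ := by
    refine ne_top_of_le_ne_top hfin ?_
    rw [stuffle]; exact le_add_self
  have h14 : Z 0 [1, 4] ≠ ⊤ := by
    intro h
    apply hfin
    rw [shuffle, h]
    simp
  have e1 := shuffle.symm.trans stuffle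
  have e2 := sumformula
  lift Z 0 [5] to NNReal using h5 with z5
  lift Z 0 [3, 2] to NNReal using h32 with z32
  lift Z 0 [2, 3] to NNReal using h23 with z23
  lift Z 0 [1, 4] to NNReal using h14 with z14
  norm_cast at e1 e2
  have e1' := congrArg (fun x : NNReal => (x : ℝ)) e1
  have e2' := congrArg (fun x : NNReal => (x : ℝ)) e2
  push_cast at e1' e2'
  simp only [ENNReal.coe_toReal]
  linarith
end

section
/- The weight-5 multiple zeta values satisfy 4ζ(2,3) = −6ζ(2,1,2) + 5ζ(1,1,1,2) and ζ(3,2) = ζ(2,1,2). -/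
open scoped ENNReal

/-- Reciprocal in `ENNReal`, zero at zero. -/
noncomputable def rr (n : ℕ) : ℝ≥0∞ := ENNReal.ofReal ((n : ℝ)⁻¹)
/-- Indicator of `b < m`. -/
noncomputable def ii (b m : ℕ) : ℝ≥0∞ := if b < m then 1 else 0
/-- Connector. -/
noncomputable def cr (m n : ℕ) : ℝ := (m.factorial * n.factorial : ℝ) / ((m + n).factorial : ℝ)
/-- Connector in `ENNReal`. -/
noncomputable def cc (m n : ℕ) : ℝ≥0∞ := ENNReal.ofReal (cr m n)

/-- Iterated sums with a connector at the end. -/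
noncomputable def VV : List ℕ → ℕ → ℕ → ℝ≥0∞
  | [], m, b => cc m b
  | (a :: l), m, b => ∑' n : ℕ, ii b n * (rr n ^ a * VV l m n)

lemma tele (f : ℕ → ℝ) (hf : Antitone f) (h0 : Filter.Tendsto f Filter.atTop (nhds 0)) :
    HasSum (fun k => f k - f (k + 1)) (f 0) := by
  rw [hasSum_iff_tendsto_nat_of_nonneg (fun k => sub_nonneg.2 (hf (Nat.le_succ k)))]
  simp_rw [Finset.sum_range_sub']
  simpa using h0.const_sub (f 0)

lemma cr_pos (m n : ℕ) : 0 < cr m n := by unfold cr; positivity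

lemma cr_comm (m n : ℕ) : cr m n = cr n m := by
  unfold cr; rw [add_comm m n, mul_comm]

lemma cc_comm (m n : ℕ) : cc m n = cc n m := by
  unfold cc; rw [cr_comm]

lemma cr_zero (n : ℕ) : cr 0 n = 1 := by
  
  have h : (n.factorial : ℝ) ≠ 0 := by positivity
  unfold cr
  rw [zero_add, Nat.factorial_zero, Nat.cast_one, one_mul, div_self h]

lemma cr_succ (m n : ℕ) : cr m (n + 1) * (m + n + 1) = cr m n * (n + 1) := by
  unfold cr
  rw [← add_assoc, Nat.factorial_succ, Nat.factorial_succ]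
  push_cast
  field_simp

lemma cr_anti (m : ℕ) : Antitone (cr m) := by
  apply antitone_nat_of_succ_le
  intro n
  have h := cr_succ m n
  have h1 := cr_pos m (n + 1)
  have h2 := cr_pos m n
  have : (0 : ℝ) ≤ m := by positivity
  have : (0 : ℝ) ≤ n := by positivity
  by_contra hc
  push Not at hc
  nlinarith

lemma cr_le (m n : ℕ) : cr (m + 1) n ≤ 1 / ((n : ℝ) + 1) := by
  rw [cr_comm]
  refine (cr_anti n (show 1 ≤ m + 1 by omega)).trans ?_
  have h := cr_succ n 0
  rw [cr_comm n 0, cr_zero] at h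
  rw [le_div_iff₀ (by positivity)]
  push_cast at h
  simp at h
  exact h.le

lemma cr_tendsto (m : ℕ) : Filter.Tendsto (cr (m + 1)) Filter.atTop (nhds 0) :=
  squeeze_zero (fun n => (cr_pos _ n).le) (cr_le m) tendsto_one_div_add_atTop_nhds_zero_nat

lemma tsum_ii (b : ℕ) (f : ℕ → ℝ≥0∞) : ∑' n, ii b n * f n = ∑' k, f (b + k + 1) := by
  rw [← Summable.sum_add_tsum_nat_add' (k := b + 1) (f := fun n => ii b n * f n) ENNReal.summable]
  have : ∑ i ∈ Finset.range (b + 1), ii b i * f i = 0 := by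
    apply Finset.sum_eq_zero
    intro i hi
    have : ¬ b < i := by simp at hi; omega
    simp [ii, this]
  rw [this, zero_add]
  apply tsum_congr
  intro k
  have : b < k + (b + 1) := by omega
  simp only [ii, this, if_true, one_mul]
  congr 1; omega

lemma transport (m b : ℕ) :
    rr m * ∑' n, ii b n * (rr n * cc m n) = rr m * (rr m * cc m b) := by
  rcases m with _ | m
  · simp [rr]
  congr 1
  rw [tsum_ii]
  have h := tele (fun k => ((m + 1 : ℕ) : ℝ)⁻¹ * cr (m + 1) (b + k))
    (by
      intro x y hxy
      have := cr_anti (m + 1) (show b + x ≤ b + y by omega)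
      simp only
      gcongr)
    (by
      have := ((cr_tendsto m).comp (Filter.tendsto_add_atTop_nat b)).const_mul (((m + 1 : ℕ) : ℝ)⁻¹)
      simp only [mul_zero] at this
      refine this.congr ?_
      intro k
      simp [add_comm])
  have e : ∀ k, rr (b + k + 1) * cc (m + 1) (b + k + 1) =
      ENNReal.ofReal (((m + 1 : ℕ) : ℝ)⁻¹ * cr (m + 1) (b + k)
        - ((m + 1 : ℕ) : ℝ)⁻¹ * cr (m + 1) (b + (k + 1))) := by
    intro k
    unfold rr cc
    rw [← ENNReal.ofReal_mul (by positivity)]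
    congr 1
    have := cr_succ (m + 1) (b + k)
    rw [← add_assoc]
    have h2 : cr (m + 1) (b + k) = cr (m + 1) (b + k + 1) * (((m + 1 : ℕ) : ℝ) + (b + k : ℕ) + 1) / ((b + k : ℕ) + 1) := by
      rw [this]; field_simp
    rw [h2]
    push_cast
    field_simp
    ring
  simp_rw [e]
  rw [← ENNReal.ofReal_tsum_of_nonneg _ h.summable, h.tsum_eq]
  · unfold rr cc
    rw [← ENNReal.ofReal_mul (by positivity)]
    simp
  · intro k
    have := cr_anti (m + 1) (show b + k ≤ b + (k + 1) by omega)
    rw [← mul_sub]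
    apply mul_nonneg (by positivity); linarith

lemma VV_snoc (l : List ℕ) (m b : ℕ) :
    rr m * VV (l ++ [1]) m b = rr m * (rr m * VV l m b) := by
  induction l generalizing b with
  | nil =>
    simp only [List.nil_append, VV, pow_one]
    exact transport m b
  | cons a l ih =>
    simp only [List.cons_append, VV]
    rw [← ENNReal.tsum_mul_left, ← ENNReal.tsum_mul_left, ← ENNReal.tsum_mul_left]
    apply tsum_congr
    intro n
    have := ih n
    calc _ = ii b n * (rr n ^ a * (rr m * VV (l ++ [1]) m n)) := by ring
      _ = _ := by rw [this]; ring

lemma VV_close (l : List ℕ) (a c b : ℕ) :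
    ∑' m, ii c m * (rr m * VV (l ++ [a + 1]) m b) = VV (l ++ [a + 2]) c b := by
  induction l generalizing b with
  | nil =>
    simp only [List.nil_append, VV]
    simp_rw [← ENNReal.tsum_mul_left]
    rw [ENNReal.tsum_comm]
    apply tsum_congr
    intro n
    have := transport n c
    calc _ = ∑' m, (ii b n * rr n ^ a) * (rr n * (ii c m * (rr m * cc n m))) := by
            apply tsum_congr; intro m; rw [cc_comm m n]; ring
      _ = _ := by
            rw [ENNReal.tsum_mul_left, ENNReal.tsum_mul_left, this, cc_comm n c]; ring
  | cons d l ih =>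
    simp only [List.cons_append, VV]
    simp_rw [← ENNReal.tsum_mul_left]
    rw [ENNReal.tsum_comm]
    apply tsum_congr
    intro n
    rw [← ih n, ← ENNReal.tsum_mul_left, ← ENNReal.tsum_mul_left]
    apply tsum_congr; intro m; ring

lemma cc_zero (n : ℕ) : cc 0 n = 1 := by simp [cc, cr_zero]
lemma cc_zero' (n : ℕ) : cc n 0 = 1 := by rw [cc_comm, cc_zero]

lemma dual1 : VV [5] 0 0 = VV [1,1,1,2] 0 0 := by
  have := VV_close [1,1,1] 0 0 0
  simp only [List.cons_append, List.nil_append, zero_add] at this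
  rw [← this, VV]
  apply tsum_congr
  intro m
  have h1 := VV_snoc [] m 0
  have h2 := VV_snoc [1] m 0
  have h3 := VV_snoc [1,1] m 0
  have h4 := VV_snoc [1,1,1] m 0
  simp only [List.cons_append, List.nil_append] at h1 h2 h3 h4
  congr 1
  rw [h4, h3, h2, h1]
  simp [VV, cc_zero, cc_zero']
  ring

lemma dual2 : VV [3,2] 0 0 = VV [2,1,2] 0 0 := by
  have := VV_close [2,1] 0 0 0
  simp only [List.cons_append, List.nil_append, zero_add] at this
  rw [← this, VV]
  apply tsum_congr
  intro m
  have h3 := VV_snoc [2] m 0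
  have h4 := VV_snoc [2,1] m 0
  have h5 := VV_close [] 0 m 0
  simp only [List.cons_append, List.nil_append, zero_add] at h3 h4 h5
  congr 1
  rw [h4, h3, ← h5]
  have : VV [2] 0 m = ∑' m_1, ii m m_1 * (rr m_1 * VV [1] m_1 0) := by
    rw [VV]
    apply tsum_congr
    intro n
    have h1 := VV_snoc [] n 0
    simp only [List.nil_append] at h1
    rw [h1]
    simp [VV, cc_zero, cc_zero']
    ring
  rw [this]; ring

lemma VV1 (a : ℕ) : VV [a] 0 0 = ∑' m, ii 0 m * rr m ^ a := by
  simp [VV, cc_zero]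

lemma VV2 (a b : ℕ) : VV [a, b] 0 0 = ∑' m, ∑' n, ii 0 m * ii m n * (rr m ^ a * rr n ^ b) := by
  simp only [VV, cc_zero, mul_one]
  simp_rw [← ENNReal.tsum_mul_left]
  apply tsum_congr; intro m; apply tsum_congr; intro n; ring

lemma VV2' (a b : ℕ) : VV [a, b] 0 0 =
    ∑' m, ∑' k, rr (m + 1) ^ a * rr (m + k + 2) ^ b := by
  simp only [VV, cc_zero, mul_one]
  rw [tsum_ii]
  apply tsum_congr; intro m
  rw [tsum_ii, ENNReal.tsum_mul_left]
  simp only [zero_add]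
  congr 1
  apply tsum_congr; intro k
  congr 2; omega

lemma ii_cases (m n : ℕ) (x : ℝ≥0∞) :
    ii 0 m * ii 0 n * x = ii 0 m * ii m n * x + ii 0 n * ii n m * x
      + (if n = m then ii 0 m * x else 0) := by
  unfold ii
  rcases lt_trichotomy m n with h | h | h
  · have a1 : ¬ n < m := by omega
    have a2 : ¬ n = m := by omega
    have a3 : 0 < n := by omega
    simp [h, a1, a2, a3]
  · subst h
    simp
    intro h1 h2
    omega
  · have a1 : ¬ m < n := by omega
    have a2 : ¬ n = m := by omega
    have a3 : 0 < m := by omega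
    simp [h, a1, a2, a3]

lemma stuffle : VV [2] 0 0 * VV [3] 0 0 = VV [2,3] 0 0 + VV [3,2] 0 0 + VV [5] 0 0 := by
  have e : VV [3,2] 0 0 = ∑' m, ∑' n, ii 0 n * ii n m * (rr m ^ 2 * rr n ^ 3) := by
    rw [VV2, ENNReal.tsum_comm]
    apply tsum_congr; intro m; apply tsum_congr; intro n; ring
  rw [e, VV2, VV1, VV1, VV1, ← ENNReal.tsum_mul_right, ← ENNReal.tsum_add, ← ENNReal.tsum_add]
  apply tsum_congr; intro m
  have e5 : ii 0 m * rr m ^ 5 = ∑' n, if n = m then ii 0 m * (rr m ^ 2 * rr n ^ 3) else 0 := by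
    rw [tsum_eq_single m]
    · simp; ring
    · intro n hn; simp [hn]
  rw [e5, ← ENNReal.tsum_mul_left, ← ENNReal.tsum_add, ← ENNReal.tsum_add]
  apply tsum_congr; intro n
  rw [← ii_cases]; ring

lemma shuf_pt (m k : ℕ) : rr (m + 1) ^ 2 * rr (k + 1) ^ 3 =
    rr (m + 1) ^ 2 * rr (m + k + 2) ^ 3 + 3 * (rr (m + 1) ^ 1 * rr (m + k + 2) ^ 4)
    + (rr (k + 1) ^ 3 * rr (k + m + 2) ^ 2 + 2 * (rr (k + 1) ^ 2 * rr (k + m + 2) ^ 3)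
      + 3 * (rr (k + 1) ^ 1 * rr (k + m + 2) ^ 4)) := by
  rw [add_comm k m]
  have h2 : (2 : ℝ≥0∞) = ENNReal.ofReal 2 := by simp
  have h3 : (3 : ℝ≥0∞) = ENNReal.ofReal 3 := by simp
  unfold rr
  simp_rw [h2, h3]
  simp (discharger := positivity) only [← ENNReal.ofReal_pow, ← ENNReal.ofReal_mul, ← ENNReal.ofReal_add]
  congr 1
  push_cast
  field_simp
  ring

lemma shuffle : VV [2] 0 0 * VV [3] 0 0 =
    VV [2,3] 0 0 + 3 * VV [1,4] 0 0 + (VV [3,2] 0 0 + 2 * VV [2,3] 0 0 + 3 * VV [1,4] 0 0) := by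
  have key : VV [2] 0 0 * VV [3] 0 0 = ∑' m, ∑' k, rr (m + 1) ^ 2 * rr (k + 1) ^ 3 := by
    rw [VV1, VV1, tsum_ii, tsum_ii, ← ENNReal.tsum_mul_right]
    simp_rw [← ENNReal.tsum_mul_left, zero_add]
  rw [key, tsum_congr (fun m => tsum_congr (fun k => shuf_pt m k))]
  simp_rw [ENNReal.tsum_add]
  congr 1
  · simp_rw [VV2', ENNReal.tsum_mul_left]
  · simp_rw [VV2', ← ENNReal.tsum_mul_left]
    congr 1
    · congr 1
      · rw [ENNReal.tsum_comm]
      · rw [ENNReal.tsum_comm]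
    · rw [ENNReal.tsum_comm]

lemma harm_real (m : ℕ) : HasSum (fun k : ℕ => ((k : ℝ) + 1)⁻¹ - ((k : ℝ) + 1 + m)⁻¹)
    (∑ j ∈ Finset.range m, ((j : ℝ) + 1)⁻¹) := by
  induction m with
  | zero => simp
  | succ m ih =>
    rw [Finset.sum_range_succ]
    have h := tele (fun k : ℕ => ((k : ℝ) + 1 + m)⁻¹)
      (by intro x y hxy
          have : (x : ℝ) ≤ y := by exact_mod_cast hxy
          simp only
          gcongr)
      (by
        have := (tendsto_one_div_add_atTop_nhds_zero_nat (𝕜 := ℝ)).comp (Filter.tendsto_add_atTop_nat m)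
        refine this.congr ?_
        intro k
        simp; ring)
    convert ih.add h using 1
    · ext k; push_cast; ring
    · push_cast; ring

lemma harm (m : ℕ) : ∑' k, rr (k + 1) * rr (m + k + 2) =
    rr (m + 1) * ∑ j ∈ Finset.range (m + 1), rr (j + 1) := by
  have h := (harm_real (m + 1)).mul_left (((m + 1 : ℕ) : ℝ)⁻¹)
  have e : ∀ k, rr (k + 1) * rr (m + k + 2) = ENNReal.ofReal (((m + 1 : ℕ) : ℝ)⁻¹ *
      (((k : ℝ) + 1)⁻¹ - ((k : ℝ) + 1 + (m + 1 : ℕ))⁻¹)) := by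
    intro k
    unfold rr
    rw [← ENNReal.ofReal_mul (by positivity)]
    congr 1
    push_cast
    field_simp
    ring
  simp_rw [e]
  rw [← ENNReal.ofReal_tsum_of_nonneg _ h.summable, h.tsum_eq]
  · rw [ENNReal.ofReal_mul (by positivity), ENNReal.ofReal_sum_of_nonneg (fun _ _ => by positivity)]
    simp [rr]
  · intro k
    apply mul_nonneg (by positivity)
    rw [sub_nonneg]
    apply inv_anti₀ (by positivity)
    have : (0 : ℝ) ≤ ((m + 1 : ℕ) : ℝ) := by positivity
    linarith

lemma sum_pt (m k : ℕ) : rr (m + 1) ^ 3 * rr (m + k + 2) ^ 2 + rr (m + 1) ^ 2 * rr (m + k + 2) ^ 3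
    + rr (m + 1) ^ 1 * rr (m + k + 2) ^ 4 + rr (k + 1) ^ 1 * rr (k + m + 2) ^ 4
    = rr (m + 1) ^ 3 * (rr (k + 1) * rr (m + k + 2)) := by
  rw [add_comm k m]
  unfold rr
  simp (discharger := positivity) only [← ENNReal.ofReal_pow, ← ENNReal.ofReal_mul, ← ENNReal.ofReal_add]
  congr 1
  push_cast
  field_simp
  ring

lemma C_eq : VV [1,4] 0 0 = ∑' m, rr (m + 1) ^ 4 * ∑ j ∈ Finset.range m, rr (j + 1) := by
  have : ∀ m, ∑ j ∈ Finset.range m, rr (j + 1) = ∑' j, (if j < m then rr (j + 1) else 0) := by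
    intro m
    rw [tsum_eq_sum (s := Finset.range m)]
    · apply Finset.sum_congr rfl
      intro j hj
      simp at hj; simp [hj]
    · intro j hj
      simp at hj; simp [hj]
  simp_rw [this, ← ENNReal.tsum_mul_left]
  rw [ENNReal.tsum_comm]
  simp only [VV, cc_zero, mul_one]
  rw [tsum_ii]
  apply tsum_congr; intro j
  have e : ∀ m, rr (m + 1) ^ 4 * (if j < m then rr (j + 1) else 0)
      = ii j m * (rr (j + 1) * rr (m + 1) ^ 4) := by
    intro m; unfold ii; split_ifs <;> simp [mul_comm]
  simp_rw [e]
  rw [tsum_ii, tsum_ii, ENNReal.tsum_mul_left]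
  simp only [zero_add, pow_one]
  congr 1
  apply tsum_congr; intro k
  congr 2; omega

lemma sumf : VV [3,2] 0 0 + VV [2,3] 0 0 + VV [1,4] 0 0 + VV [1,4] 0 0
    = VV [5] 0 0 + VV [1,4] 0 0 := by
  have e : VV [1,4] 0 0 = ∑' m, ∑' k, rr (k + 1) ^ 1 * rr (k + m + 2) ^ 4 := by
    rw [VV2', ENNReal.tsum_comm]
  conv_lhs => rw [e]
  have e2 : ∑' m, ∑' k, rr (k + 1) ^ 1 * rr (k + m + 2) ^ 4 = VV [1,4] 0 0 := e.symm
  conv_lhs => enter [1, 2]; rw [e2]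
  rw [VV2' 3 2, VV2' 2 3]
  conv_lhs => enter [1, 2]; rw [VV2']
  simp_rw [← ENNReal.tsum_add, sum_pt, ENNReal.tsum_mul_left, harm]
  rw [C_eq, VV1, tsum_ii, ← ENNReal.tsum_add]
  apply tsum_congr; intro m
  rw [Finset.sum_range_succ, zero_add]
  ring

lemma fin1 (a : ℕ) (ha : 2 ≤ a) : VV [a] 0 0 ≠ ⊤ := by
  rw [VV1, tsum_ii]
  have hs : Summable (fun k : ℕ => (((0 + k + 1 : ℕ) : ℝ)⁻¹) ^ a) := by
    have := (summable_nat_add_iff 1).2 (Real.summable_nat_pow_inv.2 (show 1 < a by omega))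
    simpa using this
  have : ∀ k, rr (0 + k + 1) ^ a = ENNReal.ofReal ((((0 + k + 1 : ℕ) : ℝ)⁻¹) ^ a) := by
    intro k; unfold rr; rw [ENNReal.ofReal_pow (by positivity)]
  simp_rw [this]
  rw [← ENNReal.ofReal_tsum_of_nonneg (fun _ => by positivity) hs]
  exact ENNReal.ofReal_ne_top

lemma main_enn : VV [5] 0 0 ≠ ⊤ ∧ VV [2,3] 0 0 ≠ ⊤ ∧ VV [3,2] 0 0 ≠ ⊤ ∧
    4 * (VV [2,3] 0 0).toReal + 6 * (VV [3,2] 0 0).toReal = 5 * (VV [5] 0 0).toReal := by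
  have f2 := fin1 2 le_rfl
  have f3 := fin1 3 (by norm_num)
  have f5 := fin1 5 (by norm_num)
  have hp : VV [2] 0 0 * VV [3] 0 0 ≠ ⊤ := ENNReal.mul_ne_top f2 f3
  have h1 := stuffle
  have h2 := shuffle
  have h3 := sumf
  have fA : VV [2,3] 0 0 ≠ ⊤ := by intro h; apply hp; rw [h1, h]; simp
  have fB : VV [3,2] 0 0 ≠ ⊤ := by intro h; apply hp; rw [h1, h]; simp
  have fC : VV [1,4] 0 0 ≠ ⊤ := by intro h; apply hp; rw [h2, h]; simp
  refine ⟨f5, fA, fB, ?_⟩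
  rw [h1] at h2
  lift VV [5] 0 0 to NNReal using f5 with z
  lift VV [2,3] 0 0 to NNReal using fA with A
  lift VV [3,2] 0 0 to NNReal using fB with B
  lift VV [1,4] 0 0 to NNReal using fC with C
  have h2' : A + B + z = A + 3 * C + (B + 2 * A + 3 * C) := by exact_mod_cast h2
  have h3' : B + A + C + C = z + C := by exact_mod_cast h3
  have h2r : (A : ℝ) + B + z = A + 3 * C + (B + 2 * A + 3 * C) := by exact_mod_cast h2'
  have h3r : (B : ℝ) + A + C + C = z + C := by exact_mod_cast h3'
  simp only [ENNReal.coe_toReal]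
  linarith

open Classical in
lemma MM_eq (k : List ℕ) (b : ℕ) :
    (∑' f : Fin k.length → ℕ, if (StrictMono f ∧ ∀ i, b < f i) then
      ∏ i, rr (f i) ^ (k.get i) else 0) = VV k 0 b := by
  induction k generalizing b with
  | nil =>
    rw [VV, cc_zero]
    rw [tsum_eq_single (fun i => i.elim0)]
    · rw [if_pos]
      · rfl
      · exact ⟨fun i => i.elim0, fun i => i.elim0⟩
    · intro f hf; exact absurd (funext fun i => i.elim0) hf
  | cons a l ih =>
    rw [VV]
    refine ((Fin.consEquiv (fun _ : Fin (l.length + 1) => ℕ)).tsum_eq _).symm.trans ?_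
    rw [ENNReal.tsum_prod']
    apply tsum_congr; intro n
    rw [← ih n, ← ENNReal.tsum_mul_left, ← ENNReal.tsum_mul_left]
    apply tsum_congr; intro f
    have hiff : (StrictMono (Fin.cons n f : Fin (l.length + 1) → ℕ) ∧
        ∀ i, b < (Fin.cons n f : Fin (l.length + 1) → ℕ) i)
        ↔ b < n ∧ (StrictMono f ∧ ∀ i, n < f i) := by
      constructor
      · rintro ⟨h1, h2⟩
        refine ⟨by simpa using h2 0, ?_, ?_⟩
        · intro i j hij
          simpa using h1 (Fin.succ_lt_succ_iff.2 hij)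
        · intro i
          simpa using h1 (Fin.succ_pos i)
      · rintro ⟨h1, h2, h3⟩
        refine ⟨?_, ?_⟩
        · intro i j hij
          induction i using Fin.cases with
          | zero =>
            induction j using Fin.cases with
            | zero => exact absurd hij (lt_irrefl _)
            | succ j => simpa using h3 j
          | succ i =>
            induction j using Fin.cases with
            | zero => exact absurd hij (Fin.not_lt_zero _)
            | succ j => simpa using h2 (Fin.succ_lt_succ_iff.1 hij)
        · intro i
          induction i using Fin.cases with
          | zero => simpa using h1
          | succ i => simpa using h1.trans (h3 i)
    change (if (StrictMono (Fin.cons n f : Fin (l.length + 1) → ℕ) ∧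
        ∀ i, b < (Fin.cons n f : Fin (l.length + 1) → ℕ) i) then
        ∏ i : Fin (l.length + 1), rr ((Fin.cons n f : Fin (l.length + 1) → ℕ) i) ^ ((a :: l).get i)
        else 0) = _
    rw [if_congr hiff rfl rfl, Fin.prod_univ_succ]
    unfold ii
    by_cases h1 : b < n <;> by_cases h2 : (StrictMono f ∧ ∀ i, n < f i) <;> simp [h1, h2]

/-- Strictly monotone positive tuples. -/
def posEquiv (n : ℕ) : {f : Fin n → ℕ+ // StrictMono f} ≃
    {f : Fin n → ℕ // StrictMono f ∧ ∀ i, 0 < f i} where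
  toFun f := ⟨fun i => (f.1 i : ℕ), fun i j h => f.2 h, fun i => (f.1 i).pos⟩
  invFun f := ⟨fun i => ⟨f.1 i, f.2.2 i⟩, fun i j h => f.2.1 h⟩
  left_inv f := rfl
  right_inv f := rfl

lemma mzv_eq (k : List ℕ) : mzv k = (VV k 0 0).toReal := by
  classical
  rw [← MM_eq]
  have h1 : (∑' f : Fin k.length → ℕ, if (StrictMono f ∧ ∀ i, 0 < f i) then
      ∏ i, rr (f i) ^ (k.get i) else 0)
      = ∑' f : {f : Fin k.length → ℕ // StrictMono f ∧ ∀ i, 0 < f i},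
        ∏ i, rr (f.1 i) ^ (k.get i) := by
    have := tsum_subtype {f : Fin k.length → ℕ | StrictMono f ∧ ∀ i, 0 < f i}
      (fun f => ∏ i, rr (f i) ^ (k.get i))
    refine Eq.trans ?_ this.symm
    apply tsum_congr; intro f
    simp [Set.indicator_apply]
  have h2 : ∀ (m : {f : Fin k.length → ℕ+ // StrictMono f}),
      ∏ i, rr (((posEquiv k.length) m).1 i) ^ (k.get i)
      = ENNReal.ofReal (∏ i, ((m.1 i : ℝ) ^ (k.get i))⁻¹) := by
    intro m
    rw [ENNReal.ofReal_prod_of_nonneg (fun _ _ => by positivity)]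
    apply Finset.prod_congr rfl
    intro i _
    unfold rr
    rw [← ENNReal.ofReal_pow (by positivity), inv_pow]
    rfl
  rw [h1, ← (posEquiv k.length).tsum_eq]
  simp_rw [h2]
  rw [ENNReal.tsum_toReal_eq (fun _ => ENNReal.ofReal_ne_top)]
  unfold mzv
  apply tsum_congr; intro m
  rw [ENNReal.toReal_ofReal]
  exact Finset.prod_nonneg (fun _ _ => by positivity)

theorem mzv_rel_11 :
    4 * mzv [2,3] = -6 * mzv [2,1,2] + 5 * mzv [1,1,1,2] ∧ mzv [3,2] = mzv [2,1,2] := by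
  simp only [mzv_eq]
  rw [← dual1, ← dual2]
  obtain ⟨-, -, -, h⟩ := main_enn
  exact ⟨by linarith, rfl⟩
end

section
/- The weight-5 multiple zeta values satisfy ζ(5) + ζ(1,4) + ζ(2,3) + ζ(3,2) + ζ(1,1,3) + ζ(1,2,2) + ζ(2,1,2) − 3ζ(1,1,1,2) = 0. -/
open Filter Topology

namespace MZVAux

/-- Coefficients (shifted by one in `p`) of the connector. -/
noncomputable def c : ℕ → ℕ → ℕ → ℝ
  | 0, _, _ => 0
  | p + 1, 0, _ => if p = 0 then 1 else 0
  | p + 1, n + 1, m => ((n + 1) * c (p + 1) n m + c p (n + 1) m) / (n + 1 + m)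

lemma c_zero (n m : ℕ) : c 0 n m = 0 := by simp [c]

lemma c_succ_zero (p m : ℕ) : c (p + 1) 0 m = if p = 0 then 1 else 0 := by simp [c]

lemma c_rec (p n m : ℕ) :
    ((n : ℝ) + 1 + m) * c (p + 1) (n + 1) m = (n + 1) * c (p + 1) n m + c p (n + 1) m := by
  rw [c]
  have : (n : ℝ) + 1 + m ≠ 0 := by positivity
  field_simp

lemma c_nonneg (p n m : ℕ) : 0 ≤ c p n m := by
  induction p generalizing n with
  | zero => simp [c_zero]
  | succ p ih =>
    induction n with
    | zero => rw [c_succ_zero]; split_ifs <;> norm_num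
    | succ n ihn =>
      rw [c]
      have := ih (n + 1)
      positivity

lemma c_shift (p n m : ℕ) :
    ((m : ℝ) + 1) * c (p + 1) n m - c p n m
      = (n + m + 1) * c (p + 1) n (m + 1) - c p n (m + 1) := by
  induction n generalizing p with
  | zero =>
    cases p with
    | zero => simp [c_zero, c_succ_zero]
    | succ p => simp [c_succ_zero]
  | succ n ihn =>
    induction p with
    | zero =>
      have h1 := c_rec 0 n m
      have h2 := c_rec 0 n (m + 1)
      have h3 := ihn 0
      simp only [c_zero, Nat.cast_add, Nat.cast_one] at *
      have h0 : (n : ℝ) + 1 + m ≠ 0 := by positivity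
      apply mul_left_cancel₀ h0
      linear_combination (m + 1 : ℝ) * h1 - ((n : ℝ) + 1 + m) * h2 + (n + 1 : ℝ) * h3
    | succ p ihp =>
      have h1 := c_rec (p + 1) n m
      have h1' := c_rec p n m
      have h2 := c_rec (p + 1) n (m + 1)
      have h2' := c_rec p n (m + 1)
      have h3 := ihn (p + 1)
      simp only [Nat.cast_add, Nat.cast_one] at *
      have h0 : (n : ℝ) + 1 + m ≠ 0 := by positivity
      apply mul_left_cancel₀ h0
      linear_combination (m + 1 : ℝ) * h1 - h1' - ((n : ℝ) + 1 + m) * h2 + h2'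
        + (n + 1 : ℝ) * h3 + ihp

/-- Auxiliary sums of connectors. -/
noncomputable def E : ℕ → ℕ → ℕ → ℝ
  | 0, _, _ => 0
  | p + 1, n, m => (c (p + 1) n (m + 1) + E p n m) / (m + 1)

lemma E_nonneg (p n m : ℕ) : 0 ≤ E p n m := by
  induction p with
  | zero => simp [E]
  | succ p ih =>
    rw [E]
    have := c_nonneg (p + 1) n (m + 1)
    positivity

lemma d_eq (p n m : ℕ) : c p n m - c p n (m + 1) = n * E p n m := by
  induction p with
  | zero => simp [E, c_zero]
  | succ p ih =>
    have h := c_shift p n m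
    rw [E]
    have h0 : (m : ℝ) + 1 ≠ 0 := by positivity
    field_simp
    linear_combination h + ih

lemma c_tendsto_m (p n : ℕ) : Tendsto (fun m => c p (n + 1) m) atTop (𝓝 0) := by
  induction p generalizing n with
  | zero => simp [c_zero]
  | succ p ih =>
    have key : ∀ n, ∀ L : ℝ, Tendsto (fun m => c (p + 1) n m) atTop (𝓝 L) →
        Tendsto (fun m => c (p + 1) (n + 1) m) atTop (𝓝 0) := by
      intro n L hL
      have h1 := (hL.const_mul ((n : ℝ) + 1)).add (ih n)
      have h2 : Tendsto (fun m : ℕ => (n : ℝ) + 1 + m) atTop atTop :=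
        tendsto_atTop_add_const_left _ _ tendsto_natCast_atTop_atTop
      have h3 := h1.div_atTop h2
      refine h3.congr (fun m => ?_)
      rw [c]
    induction n with
    | zero =>
      apply key 0 (if p = 0 then 1 else 0)
      simp only [c_succ_zero]
      exact tendsto_const_nhds
    | succ n ihn => exact key (n + 1) 0 ihn

lemma hasSum_E (p n : ℕ) : HasSum (fun m => E p (n + 1) m) (c p (n + 1) 0 / (n + 1)) := by
  rw [hasSum_iff_tendsto_nat_of_nonneg (fun m => E_nonneg _ _ _)]
  have h1 : ∀ M, ∑ m ∈ Finset.range M, E p (n + 1) m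
      = (c p (n + 1) 0 - c p (n + 1) M) / (n + 1) := by
    intro M
    have h0 : (n : ℝ) + 1 ≠ 0 := by positivity
    rw [eq_div_iff h0, ← Finset.sum_range_sub', Finset.sum_mul]
    refine Finset.sum_congr rfl (fun m _ => ?_)
    rw [d_eq]; push_cast; ring
  simp only [h1]
  have := ((c_tendsto_m p n).const_sub (c p (n + 1) 0)).div_const ((n : ℝ) + 1)
  simpa using this

lemma lim_zero (a : ℕ) (u : ℕ → ℝ) (L : ℝ) (hu : Tendsto u atTop (𝓝 L)) (h0 : ∀ j, 0 ≤ u j)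
    (hs : Summable (fun j : ℕ => u j / ((a : ℝ) + 1 + j))) : L = 0 := by
  by_contra hL
  have hLpos : 0 < L := lt_of_le_of_ne (ge_of_tendsto' hu h0) (Ne.symm hL)
  have h1 : ∀ᶠ j in atTop, L / 2 < u j := hu.eventually (lt_mem_nhds (by linarith))
  have h2 : Summable (fun j : ℕ => (L / 2) / ((a : ℝ) + 1 + j)) := by
    refine Summable.of_norm_bounded_eventually_nat hs ?_
    filter_upwards [h1] with j hj
    rw [Real.norm_of_nonneg (by positivity)]
    gcongr
  have h3 : Summable (fun j : ℕ => 1 / (((j + (a + 1) : ℕ) : ℝ))) := by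
    refine (h2.mul_left (2 / L)).congr (fun j => ?_)
    push_cast
    field_simp
    ring
  exact Real.not_summable_one_div_natCast ((summable_nat_add_iff (a + 1)).1 h3)

lemma hasSum_c (p a m : ℕ) :
    HasSum (fun j : ℕ => c p (a + 1 + j) (m + 1) / ((a : ℝ) + 1 + j)) (E p a m) := by
  induction p with
  | zero => simp [c_zero, E]
  | succ p ih =>
    have hnn : ∀ q (j : ℕ), 0 ≤ c q (a + 1 + j) (m + 1) / ((a : ℝ) + 1 + j) := fun q j => by
      have := c_nonneg q (a + 1 + j) (m + 1)
      positivity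
    have tel : ∀ J : ℕ, c (p + 1) a (m + 1) - c (p + 1) (a + J) (m + 1)
        = (m + 1) * ∑ j ∈ Finset.range J, c (p + 1) (a + 1 + j) (m + 1) / ((a : ℝ) + 1 + j)
          - ∑ j ∈ Finset.range J, c p (a + 1 + j) (m + 1) / ((a : ℝ) + 1 + j) := by
      intro J
      have ht := Finset.sum_range_sub' (fun j => c (p + 1) (a + j) (m + 1)) J
      simp only [add_zero] at ht
      rw [← ht, Finset.mul_sum, ← Finset.sum_sub_distrib]
      refine Finset.sum_congr rfl (fun j _ => ?_)
      have h := c_rec p (a + j) (m + 1)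
      rw [show a + 1 + j = a + j + 1 by ring, show a + (j + 1) = a + j + 1 by ring]
      have h0 : (a : ℝ) + 1 + j ≠ 0 := by positivity
      field_simp
      push_cast at h
      linear_combination -h
    have hm : (0 : ℝ) < m + 1 := by positivity
    have hsum : Summable (fun j : ℕ => c (p + 1) (a + 1 + j) (m + 1) / ((a : ℝ) + 1 + j)) := by
      refine summable_of_sum_range_le (c := E (p + 1) a m) (hnn _) (fun J => ?_)
      rw [E, le_div_iff₀ hm]
      have h1 := tel J
      have h2 := c_nonneg (p + 1) (a + J) (m + 1)
      have h3 := sum_le_hasSum (Finset.range J) (fun j _ => hnn p j) ih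
      linarith
    obtain ⟨s, hs⟩ := hsum
    have t1 := hs.tendsto_sum_nat
    have t2 := ih.tendsto_sum_nat
    have t3 : Tendsto (fun J => c (p + 1) (a + J) (m + 1)) atTop
        (𝓝 (c (p + 1) a (m + 1) - ((m + 1) * s - E p a m))) := by
      refine (((t1.const_mul ((m : ℝ) + 1)).sub t2).const_sub (c (p + 1) a (m + 1))).congr
        (fun J => ?_)
      rw [← tel J]; ring
    have t4 : Tendsto (fun J => c (p + 1) (a + 1 + J) (m + 1)) atTop
        (𝓝 (c (p + 1) a (m + 1) - ((m + 1) * s - E p a m))) := by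
      refine ((tendsto_add_atTop_iff_nat 1).2 t3).congr (fun J => ?_)
      rw [show a + (J + 1) = a + 1 + J by ring]
    have hz := lim_zero a _ _ t4 (fun j => c_nonneg _ _ _) hs.summable
    have : E (p + 1) a m = s := by
      rw [E, div_eq_iff hm.ne']
      linarith
    rw [this]; exact hs

lemma E_zero_n (p m : ℕ) : E (p + 1) 0 m = (((m : ℝ) + 1) ^ (p + 1))⁻¹ := by
  induction p with
  | zero => simp [E, c_succ_zero]
  | succ p ih =>
    rw [E, ih, c_succ_zero]
    simp only [Nat.add_eq_zero_iff, one_ne_zero, and_false, if_false, zero_add]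
    field_simp
    ring

lemma hasSum_T (p m : ℕ) :
    HasSum (fun j : ℕ => E p (j + 1) m / ((j : ℝ) + 1)) (p * (((m : ℝ) + 1) ^ (p + 1))⁻¹) := by
  induction p with
  | zero => simp [E]
  | succ p ih =>
    have h := hasSum_c (p + 1) 0 m
    rw [E_zero_n] at h
    have h2 := (h.add ih).div_const ((m : ℝ) + 1)
    have e1 : (fun j : ℕ => E (p + 1) (j + 1) m / ((j : ℝ) + 1)) = fun j : ℕ =>
        (c (p + 1) (0 + 1 + j) (m + 1) / (((0 : ℕ) : ℝ) + 1 + j) + E p (j + 1) m / ((j : ℝ) + 1))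
          / ((m : ℝ) + 1) := by
      funext j
      rw [E, show 0 + 1 + j = j + 1 by ring, Nat.cast_zero, zero_add, add_comm (1 : ℝ)]
      field_simp
    have e2 : ((p + 1 : ℕ) : ℝ) * (((m : ℝ) + 1) ^ (p + 1 + 1))⁻¹
        = ((((m : ℝ) + 1) ^ (p + 1))⁻¹ + p * (((m : ℝ) + 1) ^ (p + 1))⁻¹) / ((m : ℝ) + 1) := by
      push_cast
      field_simp
      ring
    rw [e1, e2]
    exact h2

/-- Nested sums above `a`. -/
noncomputable def U : List ℕ → ℕ → ENNReal
  | [], _ => 1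
  | k :: ks, a => ∑' j : ℕ, ENNReal.ofReal ((((a + 1 + j : ℕ) : ℝ) ^ k)⁻¹) * U ks (a + 1 + j)

/-- Index set with lower bound. -/
abbrev Idx (r a : ℕ) := {f : Fin r → ℕ+ // StrictMono f ∧ ∀ i, a < (f i : ℕ)}

/-- Prepending an index. -/
def consMap (r a : ℕ) (x : Σ j : ℕ, Idx r (a + 1 + j)) : Idx (r + 1) a :=
  ⟨Fin.cons (Nat.succPNat (a + x.1)) x.2.1, by
    constructor
    · intro i j hij
      induction j using Fin.cases with
      | zero => exact absurd hij (Fin.not_lt_zero i)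
      | succ j =>
        induction i using Fin.cases with
        | zero =>
          have := x.2.2.2 j
          rw [← PNat.coe_lt_coe, Fin.cons_zero, Fin.cons_succ, Nat.succPNat_coe]
          omega
        | succ i =>
          rw [Fin.cons_succ, Fin.cons_succ]
          exact x.2.2.1 (Fin.succ_lt_succ_iff.1 hij)
    · intro i
      induction i using Fin.cases with
      | zero =>
        rw [Fin.cons_zero, Nat.succPNat_coe]
        omega
      | succ i =>
        have := x.2.2.2 i
        rw [Fin.cons_succ]
        omega⟩

lemma consMap_bij (r a : ℕ) : Function.Bijective (consMap r a) := by
  constructor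
  · rintro ⟨j, g, hg⟩ ⟨j', g', hg'⟩ h
    have h1 : (Fin.cons (Nat.succPNat (a + j)) g : Fin (r + 1) → ℕ+)
        = Fin.cons (Nat.succPNat (a + j')) g' := congrArg Subtype.val h
    have h2 := Fin.cons_inj.1 h1
    have hj : j = j' := by
      have := congrArg PNat.val h2.1
      change (a + j).succ = (a + j').succ at this
      omega
    subst hj
    have hgg := h2.2
    subst hgg
    rfl
  · rintro ⟨f, hf, hfa⟩
    have h0 := hfa 0
    refine ⟨⟨(f 0 : ℕ) - (a + 1), ⟨Fin.tail f, ?_, ?_⟩⟩, ?_⟩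
    · intro i j hij
      exact hf (Fin.succ_lt_succ_iff.2 hij)
    · intro i
      have h1 : f 0 < f i.succ := hf (Fin.succ_pos i)
      rw [← PNat.coe_lt_coe] at h1
      simp only [Fin.tail]
      omega
    · apply Subtype.ext
      simp only [consMap]
      conv_rhs => rw [← Fin.cons_self_tail f]
      congr 1
      apply PNat.eq
      rw [Nat.succPNat_coe]
      omega

lemma tsum_eq_U (k : List ℕ) (a : ℕ) :
    ∑' m : Idx k.length a, ∏ i : Fin k.length, ENNReal.ofReal (((m.1 i : ℝ) ^ (k.get i))⁻¹)
      = U k a := by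
  induction k generalizing a with
  | nil =>
    have : Unique (Idx ([] : List ℕ).length a) :=
      { default := ⟨fun i => i.elim0, fun i => i.elim0, fun i => i.elim0⟩
        uniq := fun x => Subtype.ext (funext fun i => i.elim0) }
    simp only [U]
    rw [tsum_fintype]
    simp
  | cons k ks ih =>
    rw [U]
    simp only [← ih]
    refine ((Equiv.ofBijective _ (consMap_bij ks.length a)).tsum_eq (fun m : Idx (ks.length + 1) a =>
      ∏ i : Fin (ks.length + 1),
        ENNReal.ofReal (((m.1 i : ℝ) ^ ((k :: ks).get i))⁻¹))).symm.trans ?_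
    rw [ENNReal.tsum_sigma']
    refine tsum_congr (fun j => ?_)
    rw [← ENNReal.tsum_mul_left]
    refine tsum_congr (fun g => ?_)
    rw [Fin.prod_univ_succ]
    congr 1
    simp only [Equiv.ofBijective_apply, consMap, Fin.cons_zero, Nat.succPNat_coe, List.get_cons_zero]
    rw [show a + 1 + j = (a + j).succ by omega]

lemma mzv_eq_U (k : List ℕ) : mzv k = (U k 0).toReal := by
  rw [← tsum_eq_U, mzv]
  rw [ENNReal.tsum_toReal_eq]
  · rw [← (Equiv.subtypeEquivRight (fun f : Fin k.length → ℕ+ =>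
      (⟨fun h => ⟨h, fun i => (f i).pos⟩, fun h => h.1⟩ :
        StrictMono f ↔ StrictMono f ∧ ∀ i, 0 < (f i : ℕ)))).tsum_eq]
    refine tsum_congr (fun f => ?_)
    rw [ENNReal.toReal_prod]
    refine Finset.prod_congr rfl (fun i _ => ?_)
    rw [ENNReal.toReal_ofReal (by positivity)]
    rfl
  · intro f
    exact ENNReal.prod_ne_top (fun i _ => ENNReal.ofReal_ne_top)

lemma tsum_shift (F : ℕ → ENNReal) (a : ℕ) :
    ∑' j, F (a + 1 + j) = ∑' l, if a < l then F l else 0 := by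
  have h := Summable.sum_add_tsum_nat_add' (f := fun l => if a < l then F l else 0) (k := a + 1)
    ENNReal.summable
  rw [← h]
  rw [Finset.sum_eq_zero, zero_add]
  · refine tsum_congr (fun j => ?_)
    rw [if_pos (by omega), add_comm]
  · intro i hi
    rw [Finset.mem_range] at hi
    rw [if_neg (by omega)]

lemma step (p : ℕ → ℝ) (hp : ∀ n, 0 ≤ p n) (k : ℕ) (ks : List ℕ) :
    ∑' n, ENNReal.ofReal (p n) * U (k :: ks) n
      = ∑' n : ℕ, ENNReal.ofReal (((n : ℝ) ^ k)⁻¹ * ∑ m ∈ Finset.range n, p m) * U ks n := by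
  have h1 : ∀ n, U (k :: ks) n
      = ∑' l : ℕ, if n < l then ENNReal.ofReal (((l : ℝ) ^ k)⁻¹) * U ks l else 0 := by
    intro n
    rw [U, ← tsum_shift (fun l : ℕ => ENNReal.ofReal (((l : ℝ) ^ k)⁻¹) * U ks l)]
  simp only [h1, ← ENNReal.tsum_mul_left]
  rw [ENNReal.tsum_comm]
  refine tsum_congr (fun l => ?_)
  rw [tsum_eq_sum (s := Finset.range l), ENNReal.ofReal_mul (by positivity),
    ENNReal.ofReal_sum_of_nonneg (fun i _ => hp i), Finset.mul_sum, Finset.sum_mul]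
  · refine Finset.sum_congr rfl (fun i hi => ?_)
    rw [if_pos (Finset.mem_range.1 hi)]
    ring
  · intro i hi
    rw [if_neg (by simpa using hi), mul_zero]

lemma start (k : ℕ) (ks : List ℕ) :
    U ((k + 1) :: ks) 0 = ∑' n : ℕ, ENNReal.ofReal (((n : ℝ) ^ (k + 1))⁻¹) * U ks n := by
  rw [U, tsum_shift (fun l : ℕ => ENNReal.ofReal (((l : ℝ) ^ (k + 1))⁻¹) * U ks l)]
  refine tsum_congr (fun l => ?_)
  split_ifs with h
  · rfl
  · have : l = 0 := by omega
    subst this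
    simp

lemma fin (p : ℕ → ℝ) (hp : ∀ n, 0 ≤ p n) :
    (∑' n, ENNReal.ofReal (p n) * U [] n).toReal = ∑' n, p n := by
  rw [ENNReal.tsum_toReal_eq]
  · refine tsum_congr (fun n => ?_)
    simp [U, hp n]
  · intro n
    simp [U]

/-- weights -/
noncomputable def w (k : ℕ) (n : ℕ) : ℝ := ((n : ℝ) ^ k)⁻¹

lemma w_nonneg (k n : ℕ) : 0 ≤ w k n := by unfold w; positivity

/-- one nesting step -/
noncomputable def P (k : ℕ) (p : ℕ → ℝ) (n : ℕ) : ℝ := w k n * ∑ m ∈ Finset.range n, p m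

lemma P_nonneg (k : ℕ) (p : ℕ → ℝ) (hp : ∀ n, 0 ≤ p n) (n : ℕ) : 0 ≤ P k p n :=
  mul_nonneg (w_nonneg k n) (Finset.sum_nonneg fun i _ => hp i)

lemma mzv1 (a : ℕ) : mzv [a + 1] = ∑' n, w (a + 1) n := by
  rw [mzv_eq_U, start]
  exact fin _ (w_nonneg (a + 1))

lemma mzv2 (a b : ℕ) : mzv [a + 1, b] = ∑' n, P b (w (a + 1)) n := by
  rw [mzv_eq_U, start, ← fin _ (P_nonneg b _ (w_nonneg (a + 1)))]
  exact congrArg _ (step _ (w_nonneg (a + 1)) b [])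

lemma mzv3 (a b d : ℕ) : mzv [a + 1, b, d] = ∑' n, P d (P b (w (a + 1))) n := by
  have h1 := P_nonneg b _ (w_nonneg (a + 1))
  rw [mzv_eq_U, start, ← fin _ (P_nonneg d _ h1)]
  exact congrArg _ ((step _ (w_nonneg (a + 1)) b [d]).trans (step _ h1 d []))

lemma mzv4 (a b d e : ℕ) : mzv [a + 1, b, d, e] = ∑' n, P e (P d (P b (w (a + 1)))) n := by
  have h1 := P_nonneg b _ (w_nonneg (a + 1))
  have h2 := P_nonneg d _ h1
  rw [mzv_eq_U, start, ← fin _ (P_nonneg e _ h2)]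
  exact congrArg _ (((step _ (w_nonneg (a + 1)) b [d, e]).trans (step _ h1 d [e])).trans
    (step _ h2 e []))

lemma c_one (n : ℕ) : c 1 n 0 = 1 := by
  induction n with
  | zero => simp [c_succ_zero]
  | succ n ih =>
    have h := c_rec 0 n 0
    have h0 : (n : ℝ) + 1 ≠ 0 := by positivity
    simp only [c_zero, ih, zero_add] at h
    apply mul_left_cancel₀ h0
    simpa using h

lemma c_sum (p n : ℕ) : c (p + 2) n 0 = ∑ m ∈ Finset.range (n + 1), w 1 m * c (p + 1) m 0 := by
  induction n with
  | zero => simp [c_succ_zero, w]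
  | succ n ih =>
    rw [Finset.sum_range_succ, ← ih]
    have h := c_rec (p + 1) n 0
    have h0 : (n : ℝ) + 1 ≠ 0 := by positivity
    simp only [w]
    push_cast at h ⊢
    field_simp
    linear_combination h

lemma w_mul (a b n : ℕ) : w a n * w b n = w (a + b) n := by
  simp only [w, pow_add, mul_inv]

lemma expand (n : ℕ) :
    w 2 n * c 4 n 0 = w 5 n + P 4 (w 1) n + P 3 (w 2) n + P 2 (w 3) n + P 3 (P 1 (w 1)) n
      + P 2 (P 2 (w 1)) n + P 2 (P 1 (w 2)) n + P 2 (P 1 (P 1 (w 1))) n := by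
  have e2 : ∀ m, w 1 m * c 2 m 0 = P 1 (w 1) m + w 2 m := by
    intro m
    rw [c_sum 0 m]
    simp only [zero_add, c_one, mul_one]
    rw [Finset.sum_range_succ, mul_add, w_mul, P]
  have e3 : ∀ m, w 1 m * c 3 m 0
      = P 1 (P 1 (w 1)) m + P 1 (w 2) m + P 2 (w 1) m + w 3 m := by
    intro m
    rw [c_sum 1 m]
    simp only [Nat.reduceAdd, e2]
    rw [Finset.sum_range_succ, Finset.sum_add_distrib]
    simp only [P, ← w_mul 1 1, ← w_mul 1 2]
    ring
  rw [c_sum 2 n]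
  simp only [Nat.reduceAdd, e3]
  rw [Finset.sum_range_succ, Finset.sum_add_distrib, Finset.sum_add_distrib,
    Finset.sum_add_distrib]
  simp only [P]
  rw [show w 5 n = w 2 n * w 3 n from (w_mul 2 3 n).symm,
    show w 4 n = w 2 n * w 2 n from (w_mul 2 2 n).symm,
    show w 3 n = w 2 n * w 1 n from (w_mul 2 1 n).symm]
  ring

lemma summable_w5 : Summable (w 5) := by
  exact (Real.summable_nat_pow_inv (p := 5)).2 (by norm_num)

lemma hasSum_w5 : HasSum (fun m : ℕ => (((m : ℝ) + 1) ^ 5)⁻¹) (∑' n, w 5 n) := by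
  have h := (hasSum_nat_add_iff (f := w 5) (g := ∑' n, w 5 n) 1).2 (by
    simpa [w] using summable_w5.hasSum)
  simpa [w] using h

lemma ofReal_tsum {f : ℕ → ℝ} {s : ℝ} (h0 : ∀ n, 0 ≤ f n) (h : HasSum f s) :
    ∑' n, ENNReal.ofReal (f n) = ENNReal.ofReal s := by
  rw [← h.tsum_eq, ENNReal.ofReal_tsum_of_nonneg h0 h.summable]

lemma w_succ (k n : ℕ) : w k (n + 1) = (((n : ℝ) + 1) ^ k)⁻¹ := by simp [w]

lemma hasSum_of_ofReal {f : ℕ → ℝ} {s : ℝ} (h0 : ∀ n, 0 ≤ f n) (hs : 0 ≤ s)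
    (h : ∑' n, ENNReal.ofReal (f n) = ENNReal.ofReal s) : HasSum f s := by
  have h1 : HasSum (fun n => ENNReal.ofReal (f n)) (ENNReal.ofReal s) :=
    h ▸ ENNReal.summable.hasSum
  have h2 := ENNReal.hasSum_toReal (f := fun n => ENNReal.ofReal (f n)) (by
    rw [h]; exact ENNReal.ofReal_ne_top)
  rw [← ENNReal.tsum_toReal_eq (fun n => ENNReal.ofReal_ne_top), h,
    ENNReal.toReal_ofReal hs] at h2
  simpa only [ENNReal.toReal_ofReal (h0 _)] using h2

lemma hasSum_A : HasSum (fun n => w 2 n * c 4 n 0) (4 * ∑' n, w 5 n) := by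
  have hw : 0 ≤ ∑' n, w 5 n := tsum_nonneg (w_nonneg 5)
  have h : HasSum (fun n => w 2 (n + 1) * c 4 (n + 1) 0) (4 * ∑' n, w 5 n) := by
    apply hasSum_of_ofReal
    · intro n; exact mul_nonneg (w_nonneg _ _) (c_nonneg _ _ _)
    · positivity
    · have h1 : ∀ n : ℕ, ENNReal.ofReal (w 2 (n + 1) * c 4 (n + 1) 0)
          = ∑' m, ENNReal.ofReal (E 4 (n + 1) m / ((n : ℝ) + 1)) := by
        intro n
        rw [ofReal_tsum _ ((hasSum_E 4 n).div_const ((n : ℝ) + 1))]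
        · congr 1
          rw [w_succ]
          field_simp
        · intro m
          have := E_nonneg 4 (n + 1) m
          positivity
      simp only [h1]
      rw [ENNReal.tsum_comm]
      rw [← ofReal_tsum _ (hasSum_w5.mul_left 4)]
      · refine tsum_congr (fun m => ?_)
        rw [ofReal_tsum _ (hasSum_T 4 m)]
        · norm_num
        · intro n
          have := E_nonneg 4 (n + 1) m
          positivity
      · intro m; positivity
  have h2 := (hasSum_nat_add_iff (f := fun n => w 2 n * c 4 n 0) 1).1 h
  simpa [w] using h2

lemma U_B0 (n : ℕ) : ENNReal.ofReal (w 1 (n + 1))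
    = ∑' b : ℕ, ENNReal.ofReal (w 1 (b + 1)) * ENNReal.ofReal (c 1 (n + 1) (b + 1)) := by
  have h := hasSum_E 1 n
  rw [c_one] at h
  rw [show w 1 (n + 1) = 1 / ((n : ℝ) + 1) by simp [w],
    ← ofReal_tsum (fun m => E_nonneg _ _ _) h]
  refine tsum_congr (fun b => ?_)
  rw [← ENNReal.ofReal_mul (w_nonneg _ _)]
  congr 1
  simp only [E, w]
  push_cast
  field_simp
  ring

lemma U_Bstep (q a : ℕ) :
    ∑' j : ℕ, ENNReal.ofReal (w 1 (a + 1 + j)) *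
      (∑' b : ℕ, ENNReal.ofReal (w q (b + 1)) * ENNReal.ofReal (c 1 (a + 1 + j) (b + 1)))
      = ∑' b : ℕ, ENNReal.ofReal (w (q + 1) (b + 1)) * ENNReal.ofReal (c 1 a (b + 1)) := by
  simp only [← ENNReal.tsum_mul_left]
  rw [ENNReal.tsum_comm]
  refine tsum_congr (fun b => ?_)
  have h := (hasSum_c 1 a b).mul_left (w q (b + 1))
  have h2 : w q (b + 1) * E 1 a b = w (q + 1) (b + 1) * c 1 a (b + 1) := by
    rw [← w_mul]
    simp only [E, w]
    push_cast
    field_simp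
    ring
  rw [h2] at h
  rw [← ENNReal.ofReal_mul (w_nonneg _ _), ← ofReal_tsum _ h]
  · refine tsum_congr (fun j => ?_)
    rw [← ENNReal.ofReal_mul (w_nonneg _ _), ← ENNReal.ofReal_mul (w_nonneg _ _)]
    congr 1
    simp only [w]
    push_cast
    field_simp
  · intro j
    have h1 := c_nonneg 1 (a + 1 + j) (b + 1)
    have h3 := w_nonneg q (b + 1)
    positivity

lemma U_2 (a : ℕ) : U [2] a
    = ∑' b : ℕ, ENNReal.ofReal (w 2 (b + 1)) * ENNReal.ofReal (c 1 a (b + 1)) := by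
  rw [← U_Bstep 1 a, U]
  refine tsum_congr (fun j => ?_)
  rw [show a + 1 + j = a + j + 1 by ring, ← U_B0, ← ENNReal.ofReal_mul (w_nonneg _ _), w_mul]
  simp [U, w]

lemma U_1 (q : ℕ) (ks : List ℕ) (h : ∀ a, U ks a
    = ∑' b : ℕ, ENNReal.ofReal (w q (b + 1)) * ENNReal.ofReal (c 1 a (b + 1))) (a : ℕ) :
    U (1 :: ks) a
    = ∑' b : ℕ, ENNReal.ofReal (w (q + 1) (b + 1)) * ENNReal.ofReal (c 1 a (b + 1)) := by
  rw [← U_Bstep q a, U]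
  refine tsum_congr (fun j => ?_)
  rw [h]
  rfl

lemma mzv_1112 : mzv [1, 1, 1, 2] = ∑' n, w 5 n := by
  rw [mzv_eq_U, U_1 4 _ (U_1 3 _ (U_1 2 _ U_2))]
  simp only [c_succ_zero, if_true, ENNReal.ofReal_one, mul_one, w_succ]
  rw [ofReal_tsum (fun m => by positivity) hasSum_w5,
    ENNReal.toReal_ofReal (tsum_nonneg (w_nonneg 5))]

end MZVAux

open MZVAux in
theorem mzv_rel_13 :
    mzv [5] + mzv [1,4] + mzv [2,3] + mzv [3,2] + mzv [1,1,3] + mzv [1,2,2] +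
      mzv [2,1,2] - 3 * mzv [1,1,1,2] = 0 := by
  have hA := hasSum_A
  have hw := w_nonneg
  have n1 : ∀ n, 0 ≤ w 5 n := hw 5
  have n2 : ∀ n, 0 ≤ P 4 (w 1) n := P_nonneg _ _ (hw _)
  have n3 : ∀ n, 0 ≤ P 3 (w 2) n := P_nonneg _ _ (hw _)
  have n4 : ∀ n, 0 ≤ P 2 (w 3) n := P_nonneg _ _ (hw _)
  have n5 : ∀ n, 0 ≤ P 3 (P 1 (w 1)) n := P_nonneg _ _ (P_nonneg _ _ (hw _))
  have n6 : ∀ n, 0 ≤ P 2 (P 2 (w 1)) n := P_nonneg _ _ (P_nonneg _ _ (hw _))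
  have n7 : ∀ n, 0 ≤ P 2 (P 1 (w 2)) n := P_nonneg _ _ (P_nonneg _ _ (hw _))
  have n8 : ∀ n, 0 ≤ P 2 (P 1 (P 1 (w 1))) n :=
    P_nonneg _ _ (P_nonneg _ _ (P_nonneg _ _ (hw _)))
  simp only [expand] at hA
  have s : ∀ f : ℕ → ℝ, (∀ n, 0 ≤ f n) → (∀ n, f n ≤ w 5 n + P 4 (w 1) n + P 3 (w 2) n
      + P 2 (w 3) n + P 3 (P 1 (w 1)) n
      + P 2 (P 2 (w 1)) n + P 2 (P 1 (w 2)) n + P 2 (P 1 (P 1 (w 1))) n) →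
      HasSum f (∑' n, f n) := fun f h0 h1 =>
    (Summable.of_nonneg_of_le h0 h1 hA.summable).hasSum
  have s1 := s _ n1 (fun n => by linarith [n1 n, n2 n, n3 n, n4 n, n5 n, n6 n, n7 n, n8 n])
  have s2 := s _ n2 (fun n => by linarith [n1 n, n2 n, n3 n, n4 n, n5 n, n6 n, n7 n, n8 n])
  have s3 := s _ n3 (fun n => by linarith [n1 n, n2 n, n3 n, n4 n, n5 n, n6 n, n7 n, n8 n])
  have s4 := s _ n4 (fun n => by linarith [n1 n, n2 n, n3 n, n4 n, n5 n, n6 n, n7 n, n8 n])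
  have s5 := s _ n5 (fun n => by linarith [n1 n, n2 n, n3 n, n4 n, n5 n, n6 n, n7 n, n8 n])
  have s6 := s _ n6 (fun n => by linarith [n1 n, n2 n, n3 n, n4 n, n5 n, n6 n, n7 n, n8 n])
  have s7 := s _ n7 (fun n => by linarith [n1 n, n2 n, n3 n, n4 n, n5 n, n6 n, n7 n, n8 n])
  have s8 := s _ n8 (fun n => by linarith [n1 n, n2 n, n3 n, n4 n, n5 n, n6 n, n7 n, n8 n])
  have hS := hA.unique (((((((s1.add s2).add s3).add s4).add s5).add s6).add s7).add s8)
  have hB := mzv_1112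
  have m1 : mzv [5] = _ := mzv1 4
  have m2 : mzv [1, 4] = _ := mzv2 0 4
  have m3 : mzv [2, 3] = _ := mzv2 1 3
  have m4 : mzv [3, 2] = _ := mzv2 2 2
  have m5 : mzv [1, 1, 3] = _ := mzv3 0 1 3
  have m6 : mzv [1, 2, 2] = _ := mzv3 0 2 2
  have m7 : mzv [2, 1, 2] = _ := mzv3 1 1 2
  have m8 : mzv [1, 1, 1, 2] = _ := mzv4 0 1 1 2
  simp only [zero_add, Nat.reduceAdd] at m1 m2 m3 m4 m5 m6 m7 m8
  rw [← m1, ← m2, ← m3, ← m4, ← m5, ← m6, ← m7, ← m8] at hS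
  rw [← m1] at hB
  linarith
end
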